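/- For every regular couple Q other than the trivial couple there exists a regular couple Q₀, which is either a (1,1)-mini couple or a nontrivial regular double chain, such that Q is obtained from Q₀ by replacing each pair of paired leaves of Q₀ by a regular couple; moreover each inserted regular couple has scale strictly smaller than the scale of Q. -/

import Mathlib

namespace WKE

/-! Combinatorial framework: ternary trees, couples, steps A and B, regular couples.
Following Deng–Hani, "Full derivation of the wave kinetic equation". -/

/-- A ternary tree: every non-leaf (branching) node has exactly three ordered children. -/
inductive TTree : Type where
  | leaf : TTree
  | node : TTree → TTree → TTree → TTree
  deriving DecidableEq

/-- The scale of a tree: its number of branching nodes. -/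
def TTree.scale : TTree → ℕ
  | .leaf => 0
  | .node a b c => a.scale + b.scale + c.scale + 1

/-- A position (address) of a node in a ternary tree. -/
abbrev Pos : Type := List (Fin 3)

/-- A node of a couple: a side (`true` = the `+` tree) together with a position. -/
abbrev NodeId : Type := Bool × Pos

/-- The subtree at a given position, if the position is valid. -/
def TTree.subtreeAt? : TTree → Pos → Option TTree
  | t, [] => some t
  | .leaf, _ :: _ => none
  | .node a _ _, ⟨0, _⟩ :: p => a.subtreeAt? p
  | .node _ b _, ⟨1, _⟩ :: p => b.subtreeAt? p
  | .node _ _ c, ⟨_ + 2, _⟩ :: p => c.subtreeAt? p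

/-- `p` is the position of a leaf of `t`. -/
def TTree.IsLeafPos (t : TTree) (p : Pos) : Prop := t.subtreeAt? p = some .leaf

/-- `p` is the position of a branching node of `t`. -/
def TTree.IsBranchPos (t : TTree) (p : Pos) : Prop :=
  ∃ a b c, t.subtreeAt? p = some (.node a b c)

instance (t : TTree) (p : Pos) : Decidable (t.IsLeafPos p) := by
  unfold TTree.IsLeafPos; infer_instance

/-- The sign of the node at position `p` in a tree whose root has sign `b`
(`true` = `+`): the sign flips exactly when passing to a middle child. -/
def posSign (b : Bool) (p : Pos) : Bool := Bool.xor b (p.count (1 : Fin 3) % 2 == 1)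

/-- A couple: a pair of ternary trees of signs `+` and `-`, together with a partition of the
set of all leaves into pairs of leaves of opposite signs.  The pairing is encoded as a
fixed-point-free involution of the set of leaves, extended by the identity off the leaves. -/
structure Couple where
  pos : TTree
  neg : TTree
  pair : NodeId → NodeId
  pair_leaf : ∀ x : NodeId, (cond x.1 pos neg).IsLeafPos x.2 →
    (cond (pair x).1 pos neg).IsLeafPos (pair x).2
  pair_invol : ∀ x : NodeId, (cond x.1 pos neg).IsLeafPos x.2 → pair (pair x) = x
  pair_ne : ∀ x : NodeId, (cond x.1 pos neg).IsLeafPos x.2 → pair x ≠ x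
  pair_sign : ∀ x : NodeId, (cond x.1 pos neg).IsLeafPos x.2 →
    posSign (pair x).1 (pair x).2 = !(posSign x.1 x.2)
  pair_norm : ∀ x : NodeId, ¬ (cond x.1 pos neg).IsLeafPos x.2 → pair x = x

/-- The tree of a couple on a given side. -/
def Couple.treeOf (Q : Couple) (b : Bool) : TTree := cond b Q.pos Q.neg

/-- `x` is a leaf of the couple `Q`. -/
def Couple.IsLeaf (Q : Couple) (x : NodeId) : Prop := (Q.treeOf x.1).IsLeafPos x.2

/-- `x` is a branching node of the couple `Q`. -/
def Couple.IsBranch (Q : Couple) (x : NodeId) : Prop := (Q.treeOf x.1).IsBranchPos x.2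

/-- `x` is a node of the couple `Q`. -/
def Couple.IsNode (Q : Couple) (x : NodeId) : Prop := ((Q.treeOf x.1).subtreeAt? x.2).isSome

/-- The scale of a couple: the sum of the scales of its two trees. -/
def Couple.scale (Q : Couple) : ℕ := Q.pos.scale + Q.neg.scale

theorem isLeafPos_leaf_iff (p : Pos) : TTree.IsLeafPos .leaf p ↔ p = [] := by
  cases p with
  | nil => simp [TTree.IsLeafPos, TTree.subtreeAt?]
  | cons i q => simp [TTree.IsLeafPos, TTree.subtreeAt?]

/-- The pairing of the trivial couple: the two roots are paired. -/
def trivPair : NodeId → NodeId := fun x =>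
  if x = ((true, []) : NodeId) then ((false, []) : NodeId)
  else if x = ((false, []) : NodeId) then ((true, []) : NodeId) else x

/-- The trivial couple: two single-node trees with their roots paired. -/
def trivialCouple : Couple where
  pos := .leaf
  neg := .leaf
  pair := trivPair
  pair_leaf := by
    rintro ⟨b, p⟩ hp
    have hp' : p = [] := by cases b <;> exact (isLeafPos_leaf_iff p).mp hp
    subst hp'
    cases b <;> decide
  pair_invol := by
    rintro ⟨b, p⟩ hp
    have hp' : p = [] := by cases b <;> exact (isLeafPos_leaf_iff p).mp hp
    subst hp'
    cases b <;> decide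
  pair_ne := by
    rintro ⟨b, p⟩ hp
    have hp' : p = [] := by cases b <;> exact (isLeafPos_leaf_iff p).mp hp
    subst hp'
    cases b <;> decide
  pair_sign := by
    rintro ⟨b, p⟩ hp
    have hp' : p = [] := by cases b <;> exact (isLeafPos_leaf_iff p).mp hp
    subst hp'
    cases b <;> decide
  pair_norm := by
    rintro ⟨b, p⟩ hp
    rcases p with _ | ⟨i, q⟩
    · exfalso
      apply hp
      cases b <;> exact (isLeafPos_leaf_iff []).mpr rfl
    · simp [trivPair]

/-- Replace the subtree at position `p` of `t` by `s`. -/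
def TTree.replaceAt : TTree → Pos → TTree → TTree
  | _, [], s => s
  | .leaf, _ :: _, _ => .leaf
  | .node a b c, ⟨0, _⟩ :: p, s => .node (a.replaceAt p s) b c
  | .node a b c, ⟨1, _⟩ :: p, s => .node a (b.replaceAt p s) c
  | .node a b c, ⟨_ + 2, _⟩ :: p, s => .node a b (c.replaceAt p s)

/-- The ternary tree of scale 1. -/
def oneTree : TTree := .node .leaf .leaf .leaf

/-- Normalize a candidate pairing function: act by `f` on the leaves of the couple with
trees `P`, `N`, and by the identity elsewhere. -/
def normalizePair (P N : TTree) (f : NodeId → NodeId) : NodeId → NodeId :=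
  fun x => if (cond x.1 P N).IsLeafPos x.2 then f x else x

/-- The transposition of `0` and `2` in `Fin 3`. -/
def swap02 : Fin 3 → Fin 3 := fun i => if i = 0 then 2 else if i = 2 then 0 else 1

/-- The new (raw) pairing after step A performed at the leaf pair `{l, l'}`; the children
of `l` are paired to the children of `l'` according to `σ` (which is `id` or `swap02`),
corresponding to the two possible (1,1)-mini couples. -/
def stepAPairRaw (f : NodeId → NodeId) (l l' : NodeId) (σ : Fin 3 → Fin 3) :
    NodeId → NodeId := fun x =>
  if x = (l.1, l.2 ++ [(0 : Fin 3)]) then (l'.1, l'.2 ++ [σ 0])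
  else if x = (l.1, l.2 ++ [(1 : Fin 3)]) then (l'.1, l'.2 ++ [σ 1])
  else if x = (l.1, l.2 ++ [(2 : Fin 3)]) then (l'.1, l'.2 ++ [σ 2])
  else if x = (l'.1, l'.2 ++ [σ 0]) then (l.1, l.2 ++ [(0 : Fin 3)])
  else if x = (l'.1, l'.2 ++ [σ 1]) then (l.1, l.2 ++ [(1 : Fin 3)])
  else if x = (l'.1, l'.2 ++ [σ 2]) then (l.1, l.2 ++ [(2 : Fin 3)])
  else f x

/-- Graft the tree `s` at the positions of `l` and of `l'` that lie on the side `c`. -/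
def graft2 (t : TTree) (c : Bool) (l l' : NodeId) (s : TTree) : TTree :=
  let t1 := if l.1 = c then t.replaceAt l.2 s else t
  if l'.1 = c then t1.replaceAt l'.2 s else t1

/-- Step A: `Q'` is obtained from `Q` by replacing a pair of paired leaves by a
(1,1)-mini couple. -/
def StepA (Q Q' : Couple) : Prop :=
  ∃ (l : NodeId) (σ : Fin 3 → Fin 3),
    Q.IsLeaf l ∧ (σ = id ∨ σ = swap02) ∧
    Q'.pos = graft2 Q.pos true l (Q.pair l) oneTree ∧
    Q'.neg = graft2 Q.neg false l (Q.pair l) oneTree ∧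
    Q'.pair = normalizePair Q'.pos Q'.neg (stepAPairRaw Q.pair l (Q.pair l) σ)

/-- The relative position (among the grandchildren) of the lone leaf of the mini tree with
parameters `(i, v)`. -/
def loneIdx (i : Fin 3) (v : Bool) : Fin 3 := if i = 1 then 1 else cond v 0 2

/-- The two leaf pairs (as relative positions) of the mini tree with parameters `(i, v)`:
`i` is the index of the child of the root which is a branching node, and `v` selects one of
the two admissible pairings; together `(i, v)` ranges over the six possible mini trees. -/
def bPairs (i : Fin 3) (v : Bool) : (Pos × Pos) × (Pos × Pos) :=
  if i = 1 then
    cond v ((([0], [1, 2]), ([2], [1, 0]))) ((([0], [1, 0]), ([2], [1, 2])))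
  else if i = 0 then
    (([2], [0, 1]), cond v ([1], [0, 2]) ([1], [0, 0]))
  else
    (([0], [2, 1]), cond v ([1], [2, 2]) ([1], [2, 0]))

/-- The branching child of the root of a mini tree: the subtree `S` is reattached at the
lone leaf (grandchild number `lone`). -/
def gchildT (lone : Fin 3) (S : TTree) : TTree :=
  .node (if lone = 0 then S else .leaf) (if lone = 1 then S else .leaf)
    (if lone = 2 then S else .leaf)

/-- The mini tree with branching child in position `i` and the subtree `S` reattached at the
lone leaf (grandchild number `lone`). -/
def miniT (i lone : Fin 3) (S : TTree) : TTree :=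
  .node (if i = 0 then gchildT lone S else .leaf) (if i = 1 then gchildT lone S else .leaf)
    (if i = 2 then gchildT lone S else .leaf)

/-- Relabelling of positions under step B performed at `(c, q)`: nodes below `q` on side `c`
move below the lone leaf `q ++ [i, lone]`. -/
def bump (c : Bool) (q : Pos) (i lone : Fin 3) (x : NodeId) : NodeId :=
  if x.1 = c ∧ q <+: x.2 then (x.1, q ++ i :: lone :: x.2.drop q.length) else x

/-- The new (raw) pairing after step B performed at `(c, q)` with mini tree parameters
`(i, v)`. -/
def stepBPairRaw (f : NodeId → NodeId) (c : Bool) (q : Pos) (i : Fin 3) (v : Bool) :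
    NodeId → NodeId := fun x =>
  if x = (c, q ++ (bPairs i v).1.1) then (c, q ++ (bPairs i v).1.2)
  else if x = (c, q ++ (bPairs i v).1.2) then (c, q ++ (bPairs i v).1.1)
  else if x = (c, q ++ (bPairs i v).2.1) then (c, q ++ (bPairs i v).2.2)
  else if x = (c, q ++ (bPairs i v).2.2) then (c, q ++ (bPairs i v).2.1)
  else if x.1 = c ∧ (q ++ [i, loneIdx i v]) <+: x.2 then
    bump c q i (loneIdx i v) (f (c, q ++ x.2.drop (q.length + 2)))
  else bump c q i (loneIdx i v) (f x)

/-- Step B performed at the node `(c, q)` with mini tree parameters `(i, v)`: the node is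
replaced by a mini tree, the subtree originally rooted there being reattached at the lone
leaf of the mini tree. -/
def StepBAt (Q Q' : Couple) (c : Bool) (q : Pos) (i : Fin 3) (v : Bool) : Prop :=
  ∃ S : TTree, (Q.treeOf c).subtreeAt? q = some S ∧
    Q'.treeOf c = (Q.treeOf c).replaceAt q (miniT i (loneIdx i v) S) ∧
    Q'.treeOf (!c) = Q.treeOf (!c) ∧
    Q'.pair = normalizePair Q'.pos Q'.neg (stepBPairRaw Q.pair c q i v)

/-- Step B: `Q'` is obtained from `Q` by replacing some node by a mini tree. -/
def StepB (Q Q' : Couple) : Prop := ∃ c q i v, StepBAt Q Q' c q i v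

/-- One application of step A or step B. -/
def Step (Q Q' : Couple) : Prop := StepA Q Q' ∨ StepB Q Q'

/-- A regular couple: one obtained from the trivial couple by finitely many applications of
steps A and B. -/
def Regular (Q : Couple) : Prop := Relation.ReflTransGen Step trivialCouple Q

/-- Two distinct leaf positions are siblings: same side, same parent. -/
def Siblings (x y : NodeId) : Prop :=
  x.1 = y.1 ∧ x.2 ≠ [] ∧ y.2 ≠ [] ∧ x.2.dropLast = y.2.dropLast ∧ x.2 ≠ y.2

/-- A (1,1)-mini couple: both trees have scale 1 and no siblings are paired. -/
def IsMini11 (Q : Couple) : Prop :=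
  Q.pos.scale = 1 ∧ Q.neg.scale = 1 ∧ ∀ x, Q.IsLeaf x → ¬ Siblings x (Q.pair x)

/-- `IsDoubleChain Q a b`: the couple `Q` is a regular double chain (two regular chains with
their lone leaves paired), the lone leaves being `a` and `b`.  It is built from the trivial
couple by repeatedly applying step B at a branching node or at a lone leaf. -/
inductive IsDoubleChain : Couple → NodeId → NodeId → Prop where
  | triv : IsDoubleChain trivialCouple (true, []) (false, [])
  | step {Q Q' : Couple} {a b : NodeId} {c : Bool} {q : Pos} {i : Fin 3} {v : Bool} :
      IsDoubleChain Q a b →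
      ((Q.treeOf c).IsBranchPos q ∨ (c, q) = a ∨ (c, q) = b) →
      StepBAt Q Q' c q i v →
      IsDoubleChain Q' (bump c q i (loneIdx i v) a) (bump c q i (loneIdx i v) b)

/-- A regular double chain. -/
def IsRegularDoubleChain (Q : Couple) : Prop := ∃ a b, IsDoubleChain Q a b

/-- Split a position of the big (grafted) tree into the position of the leaf of `t` it lies
under, and the remaining relative position; `none` if the position does not reach a leaf. -/
def splitAtLeaf : TTree → Pos → Option (Pos × Pos)
  | .leaf, r => some ([], r)
  | .node _ _ _, [] => none
  | .node a _ _, ⟨0, _⟩ :: r =>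
      Option.map (fun pr => ((0 : Fin 3) :: pr.1, pr.2)) (splitAtLeaf a r)
  | .node _ b _, ⟨1, _⟩ :: r =>
      Option.map (fun pr => ((1 : Fin 3) :: pr.1, pr.2)) (splitAtLeaf b r)
  | .node _ _ c, ⟨_ + 2, _⟩ :: r =>
      Option.map (fun pr => ((2 : Fin 3) :: pr.1, pr.2)) (splitAtLeaf c r)

/-- Graft, at every leaf of a tree, the tree assigned to that leaf position by `g`. -/
def graftAll (g : Pos → TTree) : TTree → Pos → TTree
  | .leaf, p => g p
  | .node t0 t1 t2, p =>
      .node (graftAll g t0 (p ++ [0])) (graftAll g t1 (p ++ [1])) (graftAll g t2 (p ++ [2]))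

/-- The (raw) pairing of the couple obtained from `Q0` by replacing each leaf pair of `Q0`
by the couple `G` assigns to it: the tree of `G l` whose root has the sign of the leaf `l`
is grafted at `l`, and the internal pairing of `G l` is transported accordingly. -/
def lrPairRaw (Q0 : Couple) (G : NodeId → Couple) : NodeId → NodeId := fun x =>
  match splitAtLeaf (Q0.treeOf x.1) x.2 with
  | none => x
  | some (p, r) =>
      let s : Bool := posSign x.1 p
      let y := (G (x.1, p)).pair (s, r)
      if y.1 = s then (x.1, p ++ y.2)
      else ((Q0.pair (x.1, p)).1, (Q0.pair (x.1, p)).2 ++ y.2)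

/-- `Q` is obtained from `Q0` by replacing each pair of paired leaves `{l, l'}` of `Q0`
by the couple `G l` (the same couple being assigned to the two leaves of a pair). -/
def LeafReplace (Q0 : Couple) (G : NodeId → Couple) (Q : Couple) : Prop :=
  (∀ l, Q0.IsLeaf l → G (Q0.pair l) = G l) ∧
  Q.pos = graftAll (fun p => (G (true, p)).treeOf (posSign true p)) Q0.pos [] ∧
  Q.neg = graftAll (fun p => (G (false, p)).treeOf (posSign false p)) Q0.neg [] ∧
  Q.pair = normalizePair Q.pos Q.neg (lrPairRaw Q0 G)

/-! ### Trees and positions -/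

/-- The child number `k`. -/
def ch (a b c : TTree) (k : Fin 3) : TTree := if k = 0 then a else if k = 1 then b else c

theorem subtree_nil (t : TTree) : t.subtreeAt? [] = some t := by
  cases t <;> rfl

theorem subtree_cons (a b c : TTree) (k : Fin 3) (p : Pos) :
    (TTree.node a b c).subtreeAt? (k :: p) = (ch a b c k).subtreeAt? p := by
  fin_cases k <;> rfl

theorem subtree_leaf_cons (k : Fin 3) (p : Pos) :
    TTree.leaf.subtreeAt? (k :: p) = none := by
  rfl

theorem leaf_node_nil (a b c : TTree) : ¬ (TTree.node a b c).IsLeafPos [] := by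
  simp [TTree.IsLeafPos, subtree_nil]

theorem leaf_node_cons (a b c : TTree) (k : Fin 3) (p : Pos) :
    (TTree.node a b c).IsLeafPos (k :: p) ↔ (ch a b c k).IsLeafPos p := by
  simp [TTree.IsLeafPos, subtree_cons]

theorem subtree_append (t : TTree) (p r : Pos) :
    t.subtreeAt? (p ++ r) = (t.subtreeAt? p).bind (fun s => s.subtreeAt? r) := by
  induction p generalizing t with
  | nil => simp [subtree_nil]
  | cons k p ih =>
    cases t with
    | leaf => simp [subtree_leaf_cons]
    | node a b c => simp [subtree_cons, ih]

theorem replace_cons (a b c : TTree) (k : Fin 3) (p : Pos) (s : TTree) :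
    (TTree.node a b c).replaceAt (k :: p) s =
      .node (if k = 0 then a.replaceAt p s else a) (if k = 1 then b.replaceAt p s else b)
        (if k = 2 then c.replaceAt p s else c) := by
  fin_cases k <;> rfl

theorem replace_nil (t s : TTree) : t.replaceAt [] s = s := by
  cases t <;> rfl

theorem leaf_no_ext {t : TTree} {p r : Pos} (h : t.IsLeafPos p)
    (h2 : (t.subtreeAt? (p ++ r)).isSome) : r = [] := by
  rw [subtree_append, h] at h2
  cases r with
  | nil => rfl
  | cons k r => simp [subtree_leaf_cons] at h2

theorem leaf_some {t : TTree} {p : Pos} (h : t.IsLeafPos p) : (t.subtreeAt? p).isSome := by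
  rw [h]; rfl

/-- A node position comparable with a leaf position is a prefix of it. -/
theorem node_prefix_leaf {t : TTree} {q l r r' : Pos} (hq : (t.subtreeAt? q).isSome)
    (hl : t.IsLeafPos l) (h : q ++ r' = l ++ r) : ∃ e, l = q ++ e ∧ r' = e ++ r := by
  rcases List.append_eq_append_iff.mp h with ⟨e, h1, h2⟩ | ⟨e, h1, h2⟩
  · exact ⟨e, h1, h2⟩
  · subst h1
    have := leaf_no_ext hl hq
    subst this
    exact ⟨[], by simp, by simpa using h2.symm⟩

theorem leaf_unique {t : TTree} {l l' r r' : Pos} (hl : t.IsLeafPos l) (hl' : t.IsLeafPos l')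
    (h : l ++ r = l' ++ r') : l = l' ∧ r = r' := by
  obtain ⟨e, h1, h2⟩ := node_prefix_leaf (leaf_some hl) hl' h
  subst h1
  have := leaf_no_ext hl (leaf_some hl')
  subst this
  simpa using h2

theorem leaf_pre_eq {t : TTree} {l l' : Pos} (hl : t.IsLeafPos l) (hl' : t.IsLeafPos l')
    (h : l <+: l') : l' = l := by
  obtain ⟨r, h⟩ := h
  exact (leaf_unique hl hl' (r' := []) (by simpa using h)).1.symm

theorem exists_leaf (t : TTree) : ∃ p, t.IsLeafPos p := by
  induction t with
  | leaf => exact ⟨[], rfl⟩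
  | node a b c iha _ _ =>
    obtain ⟨p, hp⟩ := iha
    exact ⟨0 :: p, (leaf_node_cons ..).mpr hp⟩

theorem tree_ext {t t' : TTree} (h : ∀ p, t.IsLeafPos p ↔ t'.IsLeafPos p) : t = t' := by
  induction t generalizing t' with
  | leaf =>
    cases t' with
    | leaf => rfl
    | node a b c => exact absurd ((h []).mp rfl) (leaf_node_nil a b c)
  | node a b c iha ihb ihc =>
    cases t' with
    | leaf => exact absurd ((h []).mpr rfl) (leaf_node_nil a b c)
    | node a' b' c' =>
      have h' : ∀ k p, (ch a b c k).IsLeafPos p ↔ (ch a' b' c' k).IsLeafPos p := by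
        intro k p
        rw [← leaf_node_cons, ← leaf_node_cons]; exact h _
      rw [iha (h' 0), ihb (h' 1), ihc (h' 2)]; rfl

theorem leaf_replace {t S : TTree} {q : Pos} (s : TTree) (hq : t.subtreeAt? q = some S) (p : Pos) :
    (t.replaceAt q s).IsLeafPos p ↔
      (t.IsLeafPos p ∧ ¬ q <+: p) ∨ ∃ r, p = q ++ r ∧ s.IsLeafPos r := by
  induction q generalizing t p with
  | nil => simp [replace_nil]
  | cons k q ih =>
    cases t with
    | leaf => simp [subtree_leaf_cons] at hq
    | node a b c =>
      rw [subtree_cons] at hq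
      rw [replace_cons]
      cases p with
      | nil => simp [leaf_node_nil]
      | cons j p =>
        rw [leaf_node_cons, leaf_node_cons]
        by_cases hjk : j = k
        · subst hjk
          have := ih hq p
          simp only [List.cons_prefix_cons, true_and, List.cons_append, List.cons.injEq]
          rw [← this]
          fin_cases j <;> simp [ch]
        · have : ch (if k = 0 then a.replaceAt q s else a) (if k = 1 then b.replaceAt q s else b)
            (if k = 2 then c.replaceAt q s else c) j = ch a b c j := by
            revert hjk
            fin_cases j <;> fin_cases k <;> simp [ch]
          rw [this]
          simp [hjk, Ne.symm hjk]

theorem scale_replace {t S : TTree} {q : Pos} (s : TTree) (hq : t.subtreeAt? q = some S) :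
    (t.replaceAt q s).scale + S.scale = t.scale + s.scale := by
  induction q generalizing t with
  | nil =>
    rw [subtree_nil] at hq
    cases hq
    rw [replace_nil]; omega
  | cons k q ih =>
    cases t with
    | leaf => simp [subtree_leaf_cons] at hq
    | node a b c =>
      rw [subtree_cons] at hq
      have := ih hq
      rw [replace_cons]
      fin_cases k <;> simp [ch, TTree.scale] at this ⊢ <;> omega

theorem leaf_graftAll (g : Pos → TTree) (t : TTree) (p x : Pos) :
    (graftAll g t p).IsLeafPos x ↔
      ∃ l r, x = l ++ r ∧ t.IsLeafPos l ∧ (g (p ++ l)).IsLeafPos r := by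
  induction t generalizing p x with
  | leaf =>
    simp only [graftAll, isLeafPos_leaf_iff]
    constructor
    · intro h; exact ⟨[], x, by simp, rfl, by simpa using h⟩
    · rintro ⟨l, r, rfl, rfl, h⟩; simpa using h
  | node a b c iha ihb ihc =>
    cases x with
    | nil =>
      simp only [graftAll, leaf_node_nil, false_iff]
      rintro ⟨l, r, h, hl, -⟩
      have : l = [] := by simp at h; exact h.1
      subst this
      exact leaf_node_nil _ _ _ hl
    | cons k x =>
      rw [graftAll, leaf_node_cons]
      have key : (ch (graftAll g a (p ++ [0])) (graftAll g b (p ++ [1]))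
          (graftAll g c (p ++ [2])) k).IsLeafPos x ↔
          ∃ l r, x = l ++ r ∧ (ch a b c k).IsLeafPos l ∧ (g (p ++ [k] ++ l)).IsLeafPos r := by
        fin_cases k
        · exact iha _ _
        · exact ihb _ _
        · exact ihc _ _
      rw [key]
      constructor
      · rintro ⟨l, r, rfl, h1, h2⟩
        exact ⟨k :: l, r, rfl, (leaf_node_cons ..).mpr h1, by simpa using h2⟩
      · rintro ⟨l, r, h, h1, h2⟩
        cases l with
        | nil => exact absurd h1 (leaf_node_nil a b c)
        | cons j l =>
          simp only [List.cons_append, List.cons.injEq] at h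
          obtain ⟨rfl, h⟩ := h
          exact ⟨l, r, h, (leaf_node_cons ..).mp h1, by simpa using h2⟩

theorem split_cons (a b c : TTree) (k : Fin 3) (p : Pos) :
    splitAtLeaf (.node a b c) (k :: p) =
      (splitAtLeaf (ch a b c k) p).map (fun pr => (k :: pr.1, pr.2)) := by
  fin_cases k <;> rfl

theorem split_leaf {t : TTree} {l : Pos} (r : Pos) (hl : t.IsLeafPos l) :
    splitAtLeaf t (l ++ r) = some (l, r) := by
  induction l generalizing t with
  | nil =>
    cases t with
    | leaf => simp [splitAtLeaf]
    | node a b c => exact absurd hl (leaf_node_nil a b c)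
  | cons k l ih =>
    cases t with
    | leaf => simp [isLeafPos_leaf_iff] at hl
    | node a b c =>
      rw [leaf_node_cons] at hl
      rw [List.cons_append, split_cons, ih hl]; rfl

/-- Every node position of a grafted tree is a branching node of `t` or lies below a leaf. -/
theorem node_graftAll (g : Pos → TTree) (t : TTree) (p x : Pos)
    (h : ((graftAll g t p).subtreeAt? x).isSome) :
    t.IsBranchPos x ∨ ∃ l r, x = l ++ r ∧ t.IsLeafPos l ∧ ((g (p ++ l)).subtreeAt? r).isSome := by
  induction t generalizing p x with
  | leaf =>
    right
    exact ⟨[], x, rfl, rfl, by simpa [graftAll] using h⟩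
  | node a b c iha ihb ihc =>
    cases x with
    | nil => left; exact ⟨a, b, c, rfl⟩
    | cons k x =>
      rw [graftAll, subtree_cons] at h
      have key : (ch a b c k).IsBranchPos x ∨ ∃ l r, x = l ++ r ∧ (ch a b c k).IsLeafPos l ∧
          ((g (p ++ [k] ++ l)).subtreeAt? r).isSome := by
        fin_cases k
        · exact iha _ _ h
        · exact ihb _ _ h
        · exact ihc _ _ h
      rcases key with ⟨a', b', c', h⟩ | ⟨l, r, rfl, h1, h2⟩
      · left; exact ⟨a', b', c', by rw [subtree_cons]; exact h⟩
      · right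
        exact ⟨k :: l, r, rfl, (leaf_node_cons ..).mpr h1, by simpa using h2⟩

theorem posSign_append (b : Bool) (p r : Pos) :
    posSign b (p ++ r) = posSign (posSign b p) r := by
  unfold posSign
  rw [List.count_append]
  rcases Nat.mod_two_eq_zero_or_one (p.count 1) with h1 | h1 <;>
  rcases Nat.mod_two_eq_zero_or_one (r.count 1) with h2 | h2 <;>
  simp [Nat.add_mod, h1, h2]

theorem posSign_not (b : Bool) (p : Pos) : posSign (!b) p = !(posSign b p) := by
  unfold posSign
  simp

theorem posSign_nil (b : Bool) : posSign b [] = b := by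
  simp [posSign]

/-! ### Couples -/

/-- Append a relative position to a node. -/
def app (x : NodeId) (r : Pos) : NodeId := (x.1, x.2 ++ r)

/-- The sign of a node. -/
def sgn (x : NodeId) : Bool := posSign x.1 x.2

theorem sgn_app (x : NodeId) (r : Pos) : sgn (app x r) = posSign (sgn x) r :=
  posSign_append _ _ _

theorem app_nil (x : NodeId) : app x [] = x := by simp [app]

theorem app_app (x : NodeId) (r s : Pos) : app (app x r) s = app x (r ++ s) := by simp [app]

theorem app_inj {x : NodeId} {r s : Pos} : app x r = app x s ↔ r = s := by simp [app]

theorem Couple.leaf_pair {Q : Couple} {x : NodeId} (h : Q.IsLeaf x) : Q.IsLeaf (Q.pair x) :=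
  Q.pair_leaf x h

theorem Couple.pair_pair {Q : Couple} {x : NodeId} (h : Q.IsLeaf x) : Q.pair (Q.pair x) = x :=
  Q.pair_invol x h

theorem Couple.sgn_pair {Q : Couple} {x : NodeId} (h : Q.IsLeaf x) :
    sgn (Q.pair x) = !(sgn x) :=
  Q.pair_sign x h

theorem Couple.leaf_app_unique {Q : Couple} {x y : NodeId} {r s : Pos} (hx : Q.IsLeaf x)
    (hy : Q.IsLeaf y) (h : app x r = app y s) : x = y ∧ r = s := by
  obtain ⟨b, p⟩ := x
  obtain ⟨b', p'⟩ := y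
  simp only [app, Prod.mk.injEq] at h
  obtain ⟨rfl, h⟩ := h
  obtain ⟨rfl, rfl⟩ := leaf_unique (t := Q.treeOf b) hx hy h
  exact ⟨rfl, rfl⟩

theorem Couple.leaf_app {Q : Couple} {x y : NodeId} {r : Pos} (hx : Q.IsLeaf x)
    (hy : Q.IsLeaf y) (h : y = app x r) : r = [] ∧ y = x := by
  have := Q.leaf_app_unique hx hy (r := r) (s := []) (by rw [app_nil]; exact h.symm)
  exact ⟨this.2, this.1.symm⟩

theorem Couple.ext' {Q Q' : Couple} (h1 : Q.pos = Q'.pos) (h2 : Q.neg = Q'.neg)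
    (h3 : Q.pair = Q'.pair) : Q = Q' := by
  cases Q; cases Q'; simp at h1 h2 h3; subst h1 h2 h3; rfl

/-- Build a couple from two trees and a raw pairing. -/
theorem mk_couple (P N : TTree) (f : NodeId → NodeId)
    (h : ∀ x : NodeId, (cond x.1 P N).IsLeafPos x.2 →
      (cond (f x).1 P N).IsLeafPos (f x).2 ∧ f (f x) = x ∧ sgn (f x) = !(sgn x)) :
    ∃ Q : Couple, Q.pos = P ∧ Q.neg = N ∧ Q.pair = normalizePair P N f := by
  have e : ∀ x : NodeId, (cond x.1 P N).IsLeafPos x.2 → normalizePair P N f x = f x := by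
    intro x hx
    simp only [normalizePair, if_pos hx]
  refine ⟨⟨P, N, normalizePair P N f, ?_, ?_, ?_, ?_, ?_⟩, rfl, rfl, rfl⟩
  · intro x hx
    rw [e x hx]
    exact (h x hx).1
  · intro x hx
    rw [e x hx, e _ (h x hx).1]
    exact (h x hx).2.1
  · intro x hx hc
    rw [e x hx] at hc
    have := (h x hx).2.2
    rw [hc] at this
    simp at this
  · intro x hx
    rw [e x hx]
    exact (h x hx).2.2
  · intro x hx
    simp only [normalizePair, if_neg hx]

/-! ### Step B -/

/-- The two-element pairs of the mini tree. -/
def SP (i : Fin 3) (v : Bool) (a b : Pos) : Prop :=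
  (a = (bPairs i v).1.1 ∧ b = (bPairs i v).1.2) ∨ (a = (bPairs i v).1.2 ∧ b = (bPairs i v).1.1) ∨
  (a = (bPairs i v).2.1 ∧ b = (bPairs i v).2.2) ∨ (a = (bPairs i v).2.2 ∧ b = (bPairs i v).2.1)

theorem SP.symm {i : Fin 3} {v : Bool} {a b : Pos} (h : SP i v a b) : SP i v b a := by
  unfold SP at *; tauto

theorem SP.sign {i : Fin 3} {v : Bool} {a b : Pos} (h : SP i v a b) (s : Bool) :
    posSign s b = !(posSign s a) := by
  rcases h with ⟨rfl, rfl⟩ | ⟨rfl, rfl⟩ | ⟨rfl, rfl⟩ | ⟨rfl, rfl⟩ <;> revert i v s <;> decide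

theorem SP.not_lone {i : Fin 3} {v : Bool} {a b r : Pos} (h : SP i v a b) :
    a ≠ i :: loneIdx i v :: r := by
  rintro rfl
  rcases h with ⟨h, -⟩ | ⟨h, -⟩ | ⟨h, -⟩ | ⟨h, -⟩ <;> revert h <;> revert i v <;>
    simp [bPairs, loneIdx, Fin.forall_fin_succ]

theorem leaf_mini (i : Fin 3) (v : Bool) (S : TTree) (p : Pos) :
    (miniT i (loneIdx i v) S).IsLeafPos p ↔
      (∃ r, p = i :: loneIdx i v :: r ∧ S.IsLeafPos r) ∨ ∃ b, SP i v p b := by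
  rcases p with _ | ⟨k, _ | ⟨j, r⟩⟩
  · simp only [miniT, leaf_node_nil]
    revert i v
    simp [SP, bPairs, loneIdx, Fin.forall_fin_succ]
  · simp only [miniT, leaf_node_cons]
    revert i v k
    simp [SP, bPairs, loneIdx, Fin.forall_fin_succ, ch, gchildT, leaf_node_nil,
      isLeafPos_leaf_iff]
  · simp only [miniT, leaf_node_cons]
    revert i v k j
    simp [SP, bPairs, loneIdx, Fin.forall_fin_succ, ch, gchildT, leaf_node_cons,
      isLeafPos_leaf_iff]

theorem scale_mini (i : Fin 3) (v : Bool) (S : TTree) :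
    (miniT i (loneIdx i v) S).scale = S.scale + 2 := by
  revert i v
  simp [loneIdx, miniT, gchildT, TTree.scale, Fin.forall_fin_succ]

theorem bump_under (c : Bool) (q r : Pos) (i j : Fin 3) :
    bump c q i j (c, q ++ r) = (c, q ++ i :: j :: r) := by
  simp [bump]

theorem bump_not {c : Bool} {q : Pos} (i j : Fin 3) {x : NodeId}
    (h : ∀ r, x ≠ (c, q ++ r)) : bump c q i j x = x := by
  unfold bump
  rw [if_neg]
  rintro ⟨h1, r, h2⟩
  exact h r (by rw [← h1, h2])

theorem bump_cases (c : Bool) (q : Pos) (i j : Fin 3) (x : NodeId) :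
    (∃ r, x = (c, q ++ r) ∧ bump c q i j x = (c, q ++ i :: j :: r)) ∨
    ((∀ r, x ≠ (c, q ++ r)) ∧ bump c q i j x = x) := by
  by_cases h : ∃ r, x = (c, q ++ r)
  · obtain ⟨r, rfl⟩ := h
    exact Or.inl ⟨r, rfl, bump_under ..⟩
  · push Not at h
    exact Or.inr ⟨h, bump_not i j h⟩

theorem bump_inj {c : Bool} {q : Pos} {i j : Fin 3} {x y : NodeId}
    (h : bump c q i j x = bump c q i j y) : x = y := by
  rcases bump_cases c q i j x with ⟨r, hx, hx'⟩ | ⟨hx, hx'⟩ <;>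
  rcases bump_cases c q i j y with ⟨s, hy, hy'⟩ | ⟨hy, hy'⟩ <;> rw [hx', hy'] at h
  · simp at h; rw [hx, hy, h]
  · exact absurd h.symm (hy _)
  · exact absurd h (hx _)
  · exact h

theorem sgn_bump (c : Bool) (q : Pos) (i : Fin 3) (v : Bool) (x : NodeId) :
    sgn (bump c q i (loneIdx i v) x) = sgn x := by
  rcases bump_cases c q i (loneIdx i v) x with ⟨r, hx, hx'⟩ | ⟨hx, hx'⟩
  · rw [hx', hx]
    have e : q ++ i :: loneIdx i v :: r = q ++ ([i, loneIdx i v] ++ r) := by simp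
    simp only [sgn]
    rw [e, posSign_append, posSign_append, posSign_append]
    congr 1
    clear e hx hx'
    generalize posSign c q = s
    revert i v s
    decide
  · rw [hx']

theorem bump_ne_special {c : Bool} {q : Pos} {i : Fin 3} {v : Bool} {a b : Pos} (h : SP i v a b)
    (x : NodeId) : bump c q i (loneIdx i v) x ≠ (c, q ++ a) := by
  rcases bump_cases c q i (loneIdx i v) x with ⟨r, hx, hx'⟩ | ⟨hx, hx'⟩
  · rw [hx']
    intro e
    simp at e
    exact h.not_lone e.symm
  · rw [hx']; exact hx _

theorem rawB_special (f : NodeId → NodeId) (c : Bool) (q : Pos) {i : Fin 3} {v : Bool} {a b : Pos}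
    (h : SP i v a b) : stepBPairRaw f c q i v (c, q ++ a) = (c, q ++ b) := by
  unfold stepBPairRaw
  simp only [Prod.mk.injEq, true_and, List.append_cancel_left_eq]
  rcases h with ⟨rfl, rfl⟩ | ⟨rfl, rfl⟩ | ⟨rfl, rfl⟩ | ⟨rfl, rfl⟩ <;> revert i v <;>
    simp [bPairs, Fin.forall_fin_succ]

theorem rawB_bump (f : NodeId → NodeId) (c : Bool) (q : Pos) (i : Fin 3) (v : Bool) (x : NodeId) :
    stepBPairRaw f c q i v (bump c q i (loneIdx i v) x) = bump c q i (loneIdx i v) (f x) := by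
  have hs : ∀ a b, SP i v a b → bump c q i (loneIdx i v) x ≠ (c, q ++ a) :=
    fun a b h => bump_ne_special h x
  unfold stepBPairRaw
  rw [if_neg (hs _ _ (Or.inl ⟨rfl, rfl⟩)), if_neg (hs _ _ (Or.inr (Or.inl ⟨rfl, rfl⟩))),
    if_neg (hs _ _ (Or.inr (Or.inr (Or.inl ⟨rfl, rfl⟩)))),
    if_neg (hs _ _ (Or.inr (Or.inr (Or.inr ⟨rfl, rfl⟩))))]
  rcases bump_cases c q i (loneIdx i v) x with ⟨r, hx, hx'⟩ | ⟨hx, hx'⟩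
  · rw [hx', if_pos ⟨rfl, ⟨r, by simp⟩⟩]
    subst hx
    congr 2
    simp [List.drop_append]
  · rw [hx', if_neg]
    rintro ⟨h1, r, h2⟩
    refine hx (i :: loneIdx i v :: r) ?_
    rw [← h1]
    ext1
    · rfl
    · rw [← h2]; simp

/-- Leaf-level description of step B. -/
structure SpecB (Q Q' : Couple) (c : Bool) (q : Pos) (i : Fin 3) (v : Bool) : Prop where
  leaf_iff : ∀ x, Q'.IsLeaf x ↔ (∃ y, Q.IsLeaf y ∧ x = bump c q i (loneIdx i v) y) ∨
    ∃ a b, SP i v a b ∧ x = (c, q ++ a)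
  pair_bump : ∀ y, Q.IsLeaf y → Q'.pair (bump c q i (loneIdx i v) y) =
    bump c q i (loneIdx i v) (Q.pair y)
  pair_special : ∀ a b, SP i v a b → Q'.pair (c, q ++ a) = (c, q ++ b)

theorem leaf_B {t S : TTree} {c : Bool} {q : Pos} {i : Fin 3} {v : Bool}
    (hS : t.subtreeAt? q = some S) (p : Pos) :
    (t.replaceAt q (miniT i (loneIdx i v) S)).IsLeafPos p ↔
      (∃ y, t.IsLeafPos y ∧ (c, p) = bump c q i (loneIdx i v) (c, y)) ∨
        ∃ a b, SP i v a b ∧ p = q ++ a := by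
  rw [leaf_replace _ hS]
  constructor
  · rintro (⟨h1, h2⟩ | ⟨r, rfl, h⟩)
    · left
      refine ⟨p, h1, ?_⟩
      rw [bump_not]
      intro r hr
      simp at hr
      exact h2 ⟨r, hr.symm⟩
    · rcases (leaf_mini i v S r).mp h with ⟨r', rfl, hr⟩ | ⟨b, hb⟩
      · left
        refine ⟨q ++ r', ?_, (bump_under ..).symm⟩
        unfold TTree.IsLeafPos
        rw [subtree_append, hS]; exact hr
      · right; exact ⟨r, b, hb, rfl⟩
  · rintro (⟨y, hy, he⟩ | ⟨a, b, hab, rfl⟩)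
    · rcases bump_cases c q i (loneIdx i v) (c, y) with ⟨r, hx, hx'⟩ | ⟨hx, hx'⟩
      · right
        rw [hx'] at he
        simp at he hx
        subst he hx
        refine ⟨_, rfl, (leaf_mini i v S _).mpr (Or.inl ⟨r, rfl, ?_⟩)⟩
        unfold TTree.IsLeafPos at hy
        rw [subtree_append, hS] at hy; exact hy
      · left
        rw [hx'] at he
        simp at he
        subst he
        refine ⟨hy, ?_⟩
        rintro ⟨r, rfl⟩
        exact hx r rfl
    · right
      exact ⟨a, rfl, (leaf_mini i v S _).mpr (Or.inr ⟨b, hab⟩)⟩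

theorem leaf_B_couple {Q : Couple} {P N S : TTree} {c : Bool} {q : Pos} {i : Fin 3} {v : Bool}
    (hS : (Q.treeOf c).subtreeAt? q = some S)
    (h1 : cond c P N = (Q.treeOf c).replaceAt q (miniT i (loneIdx i v) S))
    (h2 : cond (!c) P N = Q.treeOf (!c)) (x : NodeId) :
    (cond x.1 P N).IsLeafPos x.2 ↔ (∃ y, Q.IsLeaf y ∧ x = bump c q i (loneIdx i v) y) ∨
      ∃ a b, SP i v a b ∧ x = (c, q ++ a) := by
  obtain ⟨d, p⟩ := x
  by_cases hd : d = c
  · subst hd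
    simp only
    rw [h1, leaf_B (c := d) hS]
    constructor
    · rintro (⟨y, hy, he⟩ | ⟨a, b, hab, rfl⟩)
      · exact Or.inl ⟨(d, y), hy, he⟩
      · exact Or.inr ⟨a, b, hab, rfl⟩
    · rintro (⟨⟨d', y⟩, hy, he⟩ | ⟨a, b, hab, he⟩)
      · have : d' = d := by
          rcases bump_cases d q i (loneIdx i v) (d', y) with ⟨r, hx, hx'⟩ | ⟨hx, hx'⟩
          · simp at hx; exact hx.1
          · rw [hx'] at he; simp at he; exact he.1.symm
        subst this
        exact Or.inl ⟨y, hy, he⟩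
      · simp at he; exact Or.inr ⟨a, b, hab, he⟩
  · have hd' : d = !c := by revert hd; cases d <;> cases c <;> simp
    subst hd'
    simp only
    rw [h2]
    constructor
    · intro h
      left
      refine ⟨(!c, p), h, ?_⟩
      rw [bump_not]
      intro r hr
      simp at hr
    · rintro (⟨⟨d', y⟩, hy, he⟩ | ⟨a, b, hab, he⟩)
      · rcases bump_cases c q i (loneIdx i v) (d', y) with ⟨r, hx, hx'⟩ | ⟨hx, hx'⟩
        · rw [hx'] at he; simp at he
        · rw [hx'] at he
          rw [← he] at hy
          exact hy
      · simp at he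

theorem StepBAt.spec {Q Q' : Couple} {c : Bool} {q : Pos} {i : Fin 3} {v : Bool}
    (h : StepBAt Q Q' c q i v) : SpecB Q Q' c q i v := by
  obtain ⟨S, hS, h1, h2, h3⟩ := h
  have hl : ∀ x, Q'.IsLeaf x ↔ (∃ y, Q.IsLeaf y ∧ x = bump c q i (loneIdx i v) y) ∨
    ∃ a b, SP i v a b ∧ x = (c, q ++ a) := leaf_B_couple hS h1 h2
  have hp : ∀ x, Q'.IsLeaf x → Q'.pair x = stepBPairRaw Q.pair c q i v x := by
    intro x hx
    rw [h3]
    exact if_pos hx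
  refine ⟨hl, ?_, ?_⟩
  · intro y hy
    rw [hp _ ((hl _).mpr (Or.inl ⟨y, hy, rfl⟩)), rawB_bump]
  · intro a b hab
    rw [hp _ ((hl _).mpr (Or.inr ⟨a, b, hab, rfl⟩)), rawB_special _ _ _ hab]

theorem exists_stepB (Q : Couple) (c : Bool) (q : Pos) (i : Fin 3) (v : Bool)
    (hq : ((Q.treeOf c).subtreeAt? q).isSome) : ∃ Q', StepBAt Q Q' c q i v := by
  obtain ⟨S, hS⟩ := Option.isSome_iff_exists.mp hq
  obtain ⟨P, N, h1, h2⟩ : ∃ P N : TTree,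
      cond c P N = (Q.treeOf c).replaceAt q (miniT i (loneIdx i v) S) ∧
      cond (!c) P N = Q.treeOf (!c) := by
    cases c
    · exact ⟨Q.treeOf true, (Q.treeOf false).replaceAt q (miniT i (loneIdx i v) S), rfl, rfl⟩
    · exact ⟨(Q.treeOf true).replaceAt q (miniT i (loneIdx i v) S), Q.treeOf false, rfl, rfl⟩
  have hl := leaf_B_couple hS h1 h2
  obtain ⟨Q', e1, e2, e3⟩ := mk_couple P N (stepBPairRaw Q.pair c q i v) (by
    intro x hx
    rw [hl]
    rcases (hl x).mp hx with ⟨y, hy, rfl⟩ | ⟨a, b, hab, rfl⟩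
    · rw [rawB_bump, rawB_bump, Couple.pair_pair hy, sgn_bump, sgn_bump, Couple.sgn_pair hy]
      exact ⟨Or.inl ⟨_, Couple.leaf_pair hy, rfl⟩, rfl, rfl⟩
    · rw [rawB_special _ _ _ hab, rawB_special _ _ _ hab.symm]
      refine ⟨Or.inr ⟨b, a, hab.symm, rfl⟩, rfl, ?_⟩
      simp only [sgn]
      rw [posSign_append, posSign_append, hab.sign])
  refine ⟨Q', S, hS, ?_, ?_, ?_⟩
  · rw [← h1]; unfold Couple.treeOf; rw [e1, e2]
  · rw [← h2]; unfold Couple.treeOf; rw [e1, e2]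
  · rw [e1, e2, e3]

theorem StepBAt.node {Q Q' : Couple} {c : Bool} {q : Pos} {i : Fin 3} {v : Bool}
    (h : StepBAt Q Q' c q i v) : ((Q.treeOf c).subtreeAt? q).isSome := by
  obtain ⟨S, hS, -⟩ := h
  rw [hS]; rfl

theorem StepBAt.scale {Q Q' : Couple} {c : Bool} {q : Pos} {i : Fin 3} {v : Bool}
    (h : StepBAt Q Q' c q i v) : Q'.scale = Q.scale + 2 := by
  obtain ⟨S, hS, h1, h2, -⟩ := h
  have := scale_replace (miniT i (loneIdx i v) S) hS
  rw [← h1, scale_mini] at this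
  cases c <;> simp only [Couple.treeOf, Couple.scale, cond_true, cond_false, Bool.not_true,
    Bool.not_false] at * <;> rw [h2] <;> omega

/-! ### Step A -/

theorem leaf_oneTree (r : Pos) : oneTree.IsLeafPos r ↔ ∃ k, r = [k] := by
  rcases r with _ | ⟨k, r⟩
  · simp [oneTree, leaf_node_nil]
  · have : ch .leaf .leaf .leaf k = TTree.leaf := by simp [ch]
    simp [oneTree, leaf_node_cons, this, isLeafPos_leaf_iff]

/-- Graft a scale one tree at `l` if it is on the side `c`. -/
def graft1 (t : TTree) (c : Bool) (l : NodeId) : TTree :=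
  if l.1 = c then t.replaceAt l.2 oneTree else t

theorem leaf_graft1 {t : TTree} {c : Bool} {l : NodeId} (hl : l.1 = c → t.IsLeafPos l.2)
    (p : Pos) : (graft1 t c l).IsLeafPos p ↔
      (t.IsLeafPos p ∧ (c, p) ≠ l) ∨ ∃ k, (c, p) = app l [k] := by
  unfold graft1
  obtain ⟨d, l⟩ := l
  by_cases hd : d = c
  · subst hd
    replace hl : t.IsLeafPos l := hl rfl
    rw [if_pos rfl]
    rw [leaf_replace _ hl]
    simp only [leaf_oneTree, app, ne_eq, Prod.mk.injEq, true_and]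
    constructor
    · rintro (⟨h1, h2⟩ | ⟨r, rfl, k, rfl⟩)
      · exact Or.inl ⟨h1, fun e => h2 (by rw [e])⟩
      · exact Or.inr ⟨k, rfl⟩
    · rintro (⟨h1, h2⟩ | ⟨k, rfl⟩)
      · exact Or.inl ⟨h1, fun e => h2 (leaf_pre_eq hl h1 e)⟩
      · exact Or.inr ⟨_, rfl, k, rfl⟩
  · simp [hd, app, Ne.symm hd]

theorem scale_graft1 {t : TTree} {c : Bool} {l : NodeId} (hl : l.1 = c → t.IsLeafPos l.2) :
    (graft1 t c l).scale = t.scale + (if l.1 = c then 1 else 0) := by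
  unfold graft1
  split_ifs with h
  · have := scale_replace oneTree (hl h)
    simpa [oneTree, TTree.scale] using this
  · rfl

theorem graft2_eq (t : TTree) (c : Bool) (l l' : NodeId) :
    graft2 t c l l' oneTree = graft1 (graft1 t c l) c l' := rfl

theorem swap_invol {σ : Fin 3 → Fin 3} (h : σ = id ∨ σ = swap02) (k : Fin 3) : σ (σ k) = k := by
  rcases h with rfl | rfl
  · rfl
  · revert k; decide

theorem swap_sign {σ : Fin 3 → Fin 3} (h : σ = id ∨ σ = swap02) (k : Fin 3) (s : Bool) :
    posSign s [σ k] = posSign s [k] := by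
  rcases h with rfl | rfl
  · rfl
  · revert k s; decide

theorem Couple.pair_ne' {Q : Couple} {x : NodeId} (h : Q.IsLeaf x) : Q.pair x ≠ x :=
  Q.pair_ne x h

theorem leaf_app_ne {Q : Couple} {x y : NodeId} (hx : Q.IsLeaf x)
    (hy : Q.IsLeaf y) (k : Fin 3) : y ≠ app x [k] := by
  intro h
  have := (Q.leaf_app hx hy h).1
  simp at this

theorem rawA_old {Q : Couple} {l x : NodeId} (hl : Q.IsLeaf l) (hx : Q.IsLeaf x)
    (σ : Fin 3 → Fin 3) : stepAPairRaw Q.pair l (Q.pair l) σ x = Q.pair x := by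
  have h1 : ∀ k, x ≠ (l.1, l.2 ++ [k]) := leaf_app_ne hl hx
  have h2 : ∀ k, x ≠ ((Q.pair l).1, (Q.pair l).2 ++ [k]) := leaf_app_ne (Q.leaf_pair hl) hx
  simp [stepAPairRaw, h1, h2]

theorem rawA_l (f : NodeId → NodeId) (l l' : NodeId) (σ : Fin 3 → Fin 3) (k : Fin 3) :
    stepAPairRaw f l l' σ (app l [k]) = app l' [σ k] := by
  fin_cases k <;> simp [stepAPairRaw, app]

theorem rawA_l' {Q : Couple} {l : NodeId} (hl : Q.IsLeaf l) {σ : Fin 3 → Fin 3}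
    (hσ : σ = id ∨ σ = swap02) (k : Fin 3) :
    stepAPairRaw Q.pair l (Q.pair l) σ (app (Q.pair l) [k]) = app l [σ k] := by
  have hne : ∀ j j', app (Q.pair l) [j] ≠ (l.1, l.2 ++ [j']) := by
    intro j j' h
    exact Q.pair_ne' hl (Q.leaf_app_unique (Q.leaf_pair hl) hl (s := [j']) h).1
  have e : ∀ j j', (app (Q.pair l) [j] = ((Q.pair l).1, (Q.pair l).2 ++ [j'])) ↔ j = j' := by
    intro j j'
    simp [app]
  unfold stepAPairRaw
  simp only [hne, if_false, e]
  rcases hσ with rfl | rfl <;> fin_cases k <;> simp [swap02, app]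

/-- Leaf-level description of step A. -/
structure SpecA (Q Q' : Couple) (l : NodeId) (σ : Fin 3 → Fin 3) : Prop where
  leaf_iff : ∀ x, Q'.IsLeaf x ↔ (Q.IsLeaf x ∧ x ≠ l ∧ x ≠ Q.pair l) ∨
    ∃ k, x = app l [k] ∨ x = app (Q.pair l) [k]
  pair_old : ∀ x, Q.IsLeaf x → x ≠ l → x ≠ Q.pair l → Q'.pair x = Q.pair x
  pair_l : ∀ k, Q'.pair (app l [k]) = app (Q.pair l) [σ k]
  pair_l' : ∀ k, Q'.pair (app (Q.pair l) [k]) = app l [σ k]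

theorem pre_graft {Q : Couple} {l : NodeId} (hl : Q.IsLeaf l) (c : Bool) :
    (l.1 = c → (Q.treeOf c).IsLeafPos l.2) ∧
    ((Q.pair l).1 = c → (graft1 (Q.treeOf c) c l).IsLeafPos (Q.pair l).2) := by
  have h1 : l.1 = c → (Q.treeOf c).IsLeafPos l.2 := by rintro rfl; exact hl
  refine ⟨h1, ?_⟩
  intro h
  rw [leaf_graft1 h1]
  left
  subst h
  exact ⟨Q.leaf_pair hl, Q.pair_ne' hl⟩

theorem leaf_A {Q : Couple} {l : NodeId} (hl : Q.IsLeaf l) (c : Bool) (p : Pos) :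
    (graft2 (Q.treeOf c) c l (Q.pair l) oneTree).IsLeafPos p ↔
      (Q.IsLeaf (c, p) ∧ (c, p) ≠ l ∧ (c, p) ≠ Q.pair l) ∨
      ∃ k, (c, p) = app l [k] ∨ (c, p) = app (Q.pair l) [k] := by
  obtain ⟨h1, h2⟩ := pre_graft hl c
  rw [graft2_eq, leaf_graft1 h2, leaf_graft1 h1]
  have e : (Q.treeOf c).IsLeafPos p ↔ Q.IsLeaf (c, p) := Iff.rfl
  rw [e]
  constructor
  · rintro (⟨⟨a, b⟩ | ⟨k, hk⟩, d⟩ | ⟨k, hk⟩)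
    · exact Or.inl ⟨a, b, d⟩
    · exact Or.inr ⟨k, Or.inl hk⟩
    · exact Or.inr ⟨k, Or.inr hk⟩
  · rintro (⟨a, b, d⟩ | ⟨k, hk | hk⟩)
    · exact Or.inl ⟨Or.inl ⟨a, b⟩, d⟩
    · refine Or.inl ⟨Or.inr ⟨k, hk⟩, ?_⟩
      rw [hk]
      exact (leaf_app_ne hl (Q.leaf_pair hl) k).symm
    · exact Or.inr ⟨k, hk⟩

theorem leaf_A_couple {Q : Couple} {P N : TTree} {l : NodeId} (hl : Q.IsLeaf l)
    (h1 : P = graft2 Q.pos true l (Q.pair l) oneTree)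
    (h2 : N = graft2 Q.neg false l (Q.pair l) oneTree) (x : NodeId) :
    (cond x.1 P N).IsLeafPos x.2 ↔ (Q.IsLeaf x ∧ x ≠ l ∧ x ≠ Q.pair l) ∨
      ∃ k, x = app l [k] ∨ x = app (Q.pair l) [k] := by
  obtain ⟨c, p⟩ := x
  rw [← leaf_A hl]
  cases c
  · simp only [cond_false]; rw [h2]; rfl
  · simp only [cond_true]; rw [h1]; rfl

theorem spec_A {Q Q' : Couple} {l : NodeId} {σ : Fin 3 → Fin 3} (hl : Q.IsLeaf l)
    (hσ : σ = id ∨ σ = swap02)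
    (h1 : Q'.pos = graft2 Q.pos true l (Q.pair l) oneTree)
    (h2 : Q'.neg = graft2 Q.neg false l (Q.pair l) oneTree)
    (h3 : Q'.pair = normalizePair Q'.pos Q'.neg (stepAPairRaw Q.pair l (Q.pair l) σ)) :
    SpecA Q Q' l σ := by
  have hlf : ∀ x, Q'.IsLeaf x ↔ (Q.IsLeaf x ∧ x ≠ l ∧ x ≠ Q.pair l) ∨
      ∃ k, x = app l [k] ∨ x = app (Q.pair l) [k] := leaf_A_couple hl h1 h2
  have hp : ∀ x, Q'.IsLeaf x → Q'.pair x = stepAPairRaw Q.pair l (Q.pair l) σ x := by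
    intro x hx
    rw [h3]
    exact if_pos hx
  refine ⟨hlf, ?_, ?_, ?_⟩
  · intro x hx a b
    rw [hp _ ((hlf _).mpr (Or.inl ⟨hx, a, b⟩)), rawA_old hl hx]
  · intro k
    rw [hp _ ((hlf _).mpr (Or.inr ⟨k, Or.inl rfl⟩)), rawA_l]
  · intro k
    rw [hp _ ((hlf _).mpr (Or.inr ⟨k, Or.inr rfl⟩)), rawA_l' hl hσ]

theorem StepA.spec {Q Q' : Couple} (h : StepA Q Q') :
    ∃ l σ, Q.IsLeaf l ∧ (σ = id ∨ σ = swap02) ∧ SpecA Q Q' l σ := by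
  obtain ⟨l, σ, hl, hσ, h1, h2, h3⟩ := h
  exact ⟨l, σ, hl, hσ, spec_A hl hσ h1 h2 h3⟩

theorem exists_stepA (Q : Couple) (l : NodeId) (σ : Fin 3 → Fin 3) (hl : Q.IsLeaf l)
    (hσ : σ = id ∨ σ = swap02) : ∃ Q', StepA Q Q' ∧ SpecA Q Q' l σ := by
  have hlf := leaf_A_couple (Q := Q) hl rfl rfl
  obtain ⟨Q', e1, e2, e3⟩ := mk_couple (graft2 Q.pos true l (Q.pair l) oneTree)
    (graft2 Q.neg false l (Q.pair l) oneTree) (stepAPairRaw Q.pair l (Q.pair l) σ) (by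
    intro x hx
    rw [hlf]
    rcases (hlf x).mp hx with ⟨hx, a, b⟩ | ⟨k, rfl | rfl⟩
    · rw [rawA_old hl hx, rawA_old hl (Q.leaf_pair hx), Q.pair_pair hx, Q.sgn_pair hx]
      refine ⟨Or.inl ⟨Q.leaf_pair hx, ?_, ?_⟩, rfl, rfl⟩
      · intro h
        exact b (by rw [← h, Q.pair_pair hx])
      · intro h
        exact a (by rw [← Q.pair_pair hx, h, Q.pair_pair hl])
    · rw [rawA_l, rawA_l' hl hσ, swap_invol hσ, sgn_app, sgn_app, swap_sign hσ, Q.sgn_pair hl,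
        posSign_not]
      exact ⟨Or.inr ⟨_, Or.inr rfl⟩, rfl, rfl⟩
    · rw [rawA_l' hl hσ, rawA_l, swap_invol hσ, sgn_app, sgn_app, swap_sign hσ, Q.sgn_pair hl,
        posSign_not, Bool.not_not]
      exact ⟨Or.inr ⟨_, Or.inl rfl⟩, rfl, rfl⟩)
  have h3 : Q'.pair = normalizePair Q'.pos Q'.neg (stepAPairRaw Q.pair l (Q.pair l) σ) := by
    rw [e3, e1, e2]
  exact ⟨Q', ⟨l, σ, hl, hσ, e1, e2, h3⟩, spec_A hl hσ e1 e2 h3⟩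

theorem StepA.scale {Q Q' : Couple} (h : StepA Q Q') : Q'.scale = Q.scale + 2 := by
  obtain ⟨l, σ, hl, hσ, h1, h2, h3⟩ := h
  have key : ∀ c, (graft2 (Q.treeOf c) c l (Q.pair l) oneTree).scale =
      (Q.treeOf c).scale + (if l.1 = c then 1 else 0) + (if (Q.pair l).1 = c then 1 else 0) := by
    intro c
    obtain ⟨a, b⟩ := pre_graft hl c
    rw [graft2_eq, scale_graft1 b, scale_graft1 a]
  have k1 := key true
  have k2 := key false
  simp only [Couple.treeOf, cond_true, cond_false] at k1 k2
  unfold Couple.scale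
  rw [h1, h2, k1, k2]
  cases l.1 <;> cases (Q.pair l).1 <;> simp <;> omega

/-! ### Leaf replacement -/

/-- The embedding of the nodes of the couple inserted at `l` in the big couple. -/
def emb (Q0 : Couple) (l y : NodeId) : NodeId :=
  if y.1 = sgn l then app l y.2 else app (Q0.pair l) y.2

theorem emb_pair {Q0 : Couple} {l : NodeId} (hl : Q0.IsLeaf l) (y : NodeId) :
    emb Q0 (Q0.pair l) y = emb Q0 l y := by
  unfold emb
  rw [Q0.sgn_pair hl, Q0.pair_pair hl]
  cases y.1 <;> cases sgn l <;> simp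

theorem emb_self (Q0 : Couple) (l : NodeId) (r : Pos) : emb Q0 l (sgn l, r) = app l r := by
  simp [emb]

theorem emb_app (Q0 : Couple) (l y : NodeId) (r : Pos) :
    emb Q0 l (app y r) = app (emb Q0 l y) r := by
  unfold emb
  have : (app y r).1 = y.1 := rfl
  rw [this]
  split_ifs <;> simp [app]

theorem emb_cases {Q0 : Couple} {l : NodeId} (hl : Q0.IsLeaf l) (y : NodeId) :
    ∃ m, Q0.IsLeaf m ∧ (m = l ∨ m = Q0.pair l) ∧ emb Q0 l y = app m y.2 ∧ y = (sgn m, y.2) := by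
  by_cases h : y.1 = sgn l
  · refine ⟨l, hl, Or.inl rfl, by simp [emb, h], ?_⟩
    rw [← h]
  · refine ⟨Q0.pair l, Q0.leaf_pair hl, Or.inr rfl, by simp [emb, h], ?_⟩
    rw [Q0.sgn_pair hl]
    have : (!(sgn l)) = y.1 := by
      revert h; cases y.1 <;> cases sgn l <;> simp
    rw [this]

theorem emb_inj {Q0 : Couple} {l l' y y' : NodeId} {r r' : Pos} (hl : Q0.IsLeaf l)
    (hl' : Q0.IsLeaf l')
    (h : app (emb Q0 l y) r = app (emb Q0 l' y') r') :
    (l' = l ∨ l' = Q0.pair l) ∧ app y r = app y' r' := by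
  rw [← emb_app, ← emb_app] at h
  obtain ⟨m, hm, h1, h2, h3⟩ := emb_cases hl (app y r)
  obtain ⟨m', hm', h1', h2', h3'⟩ := emb_cases hl' (app y' r')
  rw [h2, h2'] at h
  obtain ⟨e1, e2⟩ := Q0.leaf_app_unique hm hm' h
  refine ⟨?_, by rw [h3, h3', e1, e2]⟩
  subst e1
  rcases h1 with rfl | rfl <;> rcases h1' with e | e
  · exact Or.inl e.symm
  · right; rw [e, Q0.pair_pair hl']
  · exact Or.inr e.symm
  · left; rw [← Q0.pair_pair hl, e, Q0.pair_pair hl']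

theorem emb_inj' {Q0 : Couple} {l l' y y' : NodeId} (hl : Q0.IsLeaf l) (hl' : Q0.IsLeaf l')
    (h : emb Q0 l y = emb Q0 l' y') : (l' = l ∨ l' = Q0.pair l) ∧ y = y' := by
  have := emb_inj hl hl' (r := []) (r' := []) (by rw [app_nil, app_nil]; exact h)
  simpa only [app_nil] using this

/-- Leaf-level description of the replacement of leaf pairs. -/
structure SpecLR (Q0 : Couple) (G : NodeId → Couple) (Q : Couple) : Prop where
  sym : ∀ l, Q0.IsLeaf l → G (Q0.pair l) = G l
  leaf_iff : ∀ x, Q.IsLeaf x ↔ ∃ l y, Q0.IsLeaf l ∧ (G l).IsLeaf y ∧ x = emb Q0 l y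
  pair_emb : ∀ l y, Q0.IsLeaf l → (G l).IsLeaf y →
    Q.pair (emb Q0 l y) = emb Q0 l ((G l).pair y)

theorem leaf_emb_iff {Q0 : Couple} {G : NodeId → Couple}
    (hG : ∀ l, Q0.IsLeaf l → G (Q0.pair l) = G l) (x : NodeId) :
    (∃ l y, Q0.IsLeaf l ∧ (G l).IsLeaf y ∧ x = emb Q0 l y) ↔
      ∃ l r, Q0.IsLeaf l ∧ (G l).IsLeaf (sgn l, r) ∧ x = app l r := by
  constructor
  · rintro ⟨l, y, hl, hy, rfl⟩
    obtain ⟨m, hm, h1, h2, h3⟩ := emb_cases hl y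
    refine ⟨m, y.2, hm, ?_, h2⟩
    rw [← h3]
    rcases h1 with rfl | rfl
    · exact hy
    · rw [hG _ hl]; exact hy
  · rintro ⟨l, r, hl, hr, rfl⟩
    exact ⟨l, _, hl, hr, (emb_self _ _ _).symm⟩

theorem leaf_graft_side (Q0 : Couple) (G : NodeId → Couple) (c : Bool) (p : Pos) :
    (graftAll (fun p => (G (c, p)).treeOf (posSign c p)) (Q0.treeOf c) []).IsLeafPos p ↔
      ∃ l r, Q0.IsLeaf l ∧ (G l).IsLeaf (sgn l, r) ∧ (c, p) = app l r := by
  rw [leaf_graftAll]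
  constructor
  · rintro ⟨l, r, rfl, h1, h2⟩
    exact ⟨(c, l), r, h1, h2, rfl⟩
  · rintro ⟨⟨d, l⟩, r, h1, h2, h3⟩
    simp only [app, Prod.mk.injEq] at h3
    obtain ⟨rfl, rfl⟩ := h3
    exact ⟨l, r, rfl, h1, h2⟩

theorem lrRaw_app {Q0 : Couple} (G : NodeId → Couple) {l : NodeId} (r : Pos)
    (hl : Q0.IsLeaf l) : lrPairRaw Q0 G (app l r) = emb Q0 l ((G l).pair (sgn l, r)) := by
  obtain ⟨c, l⟩ := l
  have := split_leaf (t := Q0.treeOf c) r hl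
  unfold lrPairRaw
  simp only [app]
  rw [this]
  rfl

theorem LeafReplace.spec {Q0 Q : Couple} {G : NodeId → Couple} (h : LeafReplace Q0 G Q) :
    SpecLR Q0 G Q := by
  obtain ⟨h0, h1, h2, h3⟩ := h
  have hl : ∀ x, Q.IsLeaf x ↔ ∃ l y, Q0.IsLeaf l ∧ (G l).IsLeaf y ∧ x = emb Q0 l y := by
    rintro ⟨c, p⟩
    rw [leaf_emb_iff h0, ← leaf_graft_side]
    cases c
    · show Q.neg.IsLeafPos p ↔ _
      rw [h2]; rfl
    · show Q.pos.IsLeafPos p ↔ _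
      rw [h1]; rfl
  refine ⟨h0, hl, ?_⟩
  intro l y hll hy
  have hx : Q.IsLeaf (emb Q0 l y) := (hl _).mpr ⟨l, y, hll, hy, rfl⟩
  have e : Q.pair (emb Q0 l y) = lrPairRaw Q0 G (emb Q0 l y) := by
    conv_lhs => rw [h3]
    exact if_pos hx
  rw [e]
  obtain ⟨m, hm, a1, a2, a3⟩ := emb_cases hll y
  rw [a2, lrRaw_app G _ hm, ← a3]
  rcases a1 with rfl | rfl
  · rfl
  · rw [h0 _ hll, emb_pair hll]

theorem SpecLR.leafReplace {Q0 Q : Couple} {G : NodeId → Couple} (h : SpecLR Q0 G Q) :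
    LeafReplace Q0 G Q := by
  refine ⟨h.sym, ?_, ?_, ?_⟩
  · apply tree_ext
    intro p
    have := leaf_graft_side Q0 G true p
    rw [← leaf_emb_iff h.sym, ← h.leaf_iff] at this
    exact this.symm
  · apply tree_ext
    intro p
    have := leaf_graft_side Q0 G false p
    rw [← leaf_emb_iff h.sym, ← h.leaf_iff] at this
    exact this.symm
  · funext x
    by_cases hx : Q.IsLeaf x
    · have e : normalizePair Q.pos Q.neg (lrPairRaw Q0 G) x = lrPairRaw Q0 G x := if_pos hx
      rw [e]
      obtain ⟨l, r, hl, hr, rfl⟩ := (leaf_emb_iff h.sym x).mp ((h.leaf_iff x).mp hx)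
      rw [lrRaw_app G _ hl, ← h.pair_emb _ _ hl hr, emb_self]
    · have e : normalizePair Q.pos Q.neg (lrPairRaw Q0 G) x = x := if_neg hx
      rw [e, Q.pair_norm x hx]

theorem LeafReplace.node {Q0 Q : Couple} {G : NodeId → Couple} (h : LeafReplace Q0 G Q)
    {c : Bool} {q : Pos} (hq : ((Q.treeOf c).subtreeAt? q).isSome) :
    (Q0.treeOf c).IsBranchPos q ∨ ∃ l r, (c, q) = app l r ∧ Q0.IsLeaf l ∧
      (((G l).treeOf (sgn l)).subtreeAt? r).isSome := by
  obtain ⟨-, h1, h2, -⟩ := h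
  have e : Q.treeOf c =
      graftAll (fun p => (G (c, p)).treeOf (posSign c p)) (Q0.treeOf c) [] := by
    cases c
    · exact h2
    · exact h1
  rw [e] at hq
  rcases node_graftAll _ _ _ _ hq with h | ⟨l, r, rfl, a, b⟩
  · exact Or.inl h
  · exact Or.inr ⟨(c, l), r, rfl, a, b⟩

/-! ### The trivial couple -/

theorem trivial_leaf (x : NodeId) : trivialCouple.IsLeaf x ↔ x.2 = [] := by
  obtain ⟨c, p⟩ := x
  cases c <;> exact isLeafPos_leaf_iff p

theorem trivial_pair (c : Bool) : trivialCouple.pair (c, []) = (!c, []) := by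
  cases c <;> decide

theorem lr_trivial (Q : Couple) : LeafReplace trivialCouple (fun _ => Q) Q := by
  apply SpecLR.leafReplace
  have e : ∀ l y : NodeId, trivialCouple.IsLeaf l → emb trivialCouple l y = y := by
    rintro ⟨c, p⟩ ⟨d, r⟩ hl
    rw [trivial_leaf] at hl
    simp only at hl
    subst hl
    unfold emb
    simp only [trivial_pair, sgn, app, posSign_nil]
    cases c <;> cases d <;> simp
  refine ⟨fun _ _ => rfl, ?_, ?_⟩
  · intro x
    constructor
    · intro h
      have ht : trivialCouple.IsLeaf (true, []) := (trivial_leaf _).mpr rfl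
      exact ⟨(true, []), x, ht, h, (e _ _ ht).symm⟩
    · rintro ⟨l, y, hl, hy, rfl⟩
      rw [e _ _ hl]; exact hy
  · intro l y hl hy
    rw [e _ _ hl, e _ _ hl]

theorem emb_root {Q : Couple} {l : NodeId} :
    emb Q l (sgn l, []) = l ∧ emb Q l (!(sgn l), []) = Q.pair l := by
  constructor
  · simp [emb, app]
  · simp [emb, app]

theorem root_cases {l y : NodeId} (hy : y.2 = []) : y = (sgn l, []) ∨ y = (!(sgn l), []) := by
  obtain ⟨d, r⟩ := y
  simp only at hy
  subst hy
  cases d <;> cases sgn l <;> simp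

theorem lr_self (Q : Couple) : LeafReplace Q (fun _ => trivialCouple) Q := by
  apply SpecLR.leafReplace
  refine ⟨fun _ _ => rfl, ?_, ?_⟩
  · intro x
    constructor
    · intro h
      exact ⟨x, (sgn x, []), h, (trivial_leaf _).mpr rfl, emb_root.1.symm⟩
    · rintro ⟨l, y, hl, hy, rfl⟩
      rw [trivial_leaf] at hy
      rcases root_cases (l := l) hy with rfl | rfl
      · rw [emb_root.1]; exact hl
      · rw [emb_root.2]; exact Q.leaf_pair hl
  · intro l y hl hy
    rw [trivial_leaf] at hy
    rcases root_cases (l := l) hy with rfl | rfl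
    · rw [trivial_pair, emb_root.1, emb_root.2]
    · rw [trivial_pair, Bool.not_not, emb_root.1, emb_root.2, Q.pair_pair hl]

/-! ### Transport of the steps through leaf replacement -/

open Classical in
/-- Change the couple inserted at the pair of `l`. -/
noncomputable def upd (Q0 : Couple) (G : NodeId → Couple) (l : NodeId) (H : Couple) :
    NodeId → Couple :=
  fun k => if k = l ∨ k = Q0.pair l then H else G k

theorem upd_sym {Q0 : Couple} {G : NodeId → Couple} {l : NodeId} (hl : Q0.IsLeaf l) (H : Couple)
    (hG : ∀ l, Q0.IsLeaf l → G (Q0.pair l) = G l) (k : NodeId) (hk : Q0.IsLeaf k) :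
    upd Q0 G l H (Q0.pair k) = upd Q0 G l H k := by
  unfold upd
  have : (Q0.pair k = l ∨ Q0.pair k = Q0.pair l) ↔ (k = l ∨ k = Q0.pair l) := by
    constructor
    · rintro (h | h)
      · right; rw [← h, Q0.pair_pair hk]
      · left; rw [← Q0.pair_pair hk, h, Q0.pair_pair hl]
    · rintro (h | h)
      · right; rw [h]
      · left; rw [h, Q0.pair_pair hl]
  rw [hG k hk]
  simp only [this]

theorem upd_self (Q0 : Couple) (G : NodeId → Couple) (l : NodeId) (H : Couple) :
    upd Q0 G l H l = H := by simp [upd]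

theorem upd_not {Q0 : Couple} (G : NodeId → Couple) {l k : NodeId} (H : Couple)
    (h : ¬ (k = l ∨ k = Q0.pair l)) : upd Q0 G l H k = G k := by
  simp only [upd, if_neg h]

/-- Case analysis for an updated family, up to the symmetry of leaf pairs. -/
theorem upd_cases {Q0 : Couple} (G : NodeId → Couple) {l k : NodeId} (hl : Q0.IsLeaf l)
    (H : Couple) :
    (upd Q0 G l H k = H ∧ ∀ y, emb Q0 k y = emb Q0 l y) ∨
    (¬ (k = l ∨ k = Q0.pair l) ∧ upd Q0 G l H k = G k) := by
  by_cases h : k = l ∨ k = Q0.pair l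
  · left
    refine ⟨by simp only [upd, if_pos h], ?_⟩
    rcases h with rfl | rfl
    · intro y; rfl
    · intro y; rw [emb_pair hl]
  · right
    exact ⟨h, upd_not G H h⟩

theorem G_cases {Q0 : Couple} {G : NodeId → Couple} {l k : NodeId} (hl : Q0.IsLeaf l)
    (hG : ∀ l, Q0.IsLeaf l → G (Q0.pair l) = G l) (h : k = l ∨ k = Q0.pair l) :
    G k = G l ∧ ∀ y, emb Q0 k y = emb Q0 l y := by
  rcases h with rfl | rfl
  · exact ⟨rfl, fun y => rfl⟩
  · exact ⟨hG _ hl, fun y => emb_pair hl y⟩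

theorem lr_stepA {Q0 Q Q' H : Couple} {G : NodeId → Couple} {l y : NodeId} {σ : Fin 3 → Fin 3}
    (h : SpecLR Q0 G Q) (hl : Q0.IsLeaf l) (hy : (G l).IsLeaf y)
    (hQ : SpecA Q Q' (emb Q0 l y) σ) (hH : SpecA (G l) H y σ) :
    SpecLR Q0 (upd Q0 G l H) Q' := by
  have hp : Q.pair (emb Q0 l y) = emb Q0 l ((G l).pair y) := h.pair_emb l y hl hy
  have other : ∀ k z, Q0.IsLeaf k → ¬ (k = l ∨ k = Q0.pair l) →
      emb Q0 k z ≠ emb Q0 l y ∧ emb Q0 k z ≠ Q.pair (emb Q0 l y) := by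
    intro k z hk hn
    rw [hp]
    constructor
    · intro e; exact hn (emb_inj' hl hk e.symm).1
    · intro e; exact hn (emb_inj' hl hk e.symm).1
  have same : ∀ z, z ≠ y → z ≠ (G l).pair y →
      emb Q0 l z ≠ emb Q0 l y ∧ emb Q0 l z ≠ Q.pair (emb Q0 l y) := by
    intro z h1 h2
    rw [hp]
    constructor
    · intro e; exact h1 (emb_inj' hl hl e).2
    · intro e; exact h2 (emb_inj' hl hl e).2
  refine ⟨upd_sym hl H h.sym, ?_, ?_⟩
  · intro x
    constructor
    · intro hx
      rcases (hQ.leaf_iff x).mp hx with ⟨hx, a, b⟩ | ⟨k, rfl | rfl⟩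
      · obtain ⟨k, z, hk, hz, rfl⟩ := (h.leaf_iff x).mp hx
        by_cases hc : k = l ∨ k = Q0.pair l
        · obtain ⟨e1, e2⟩ := G_cases hl h.sym hc
          refine ⟨l, z, hl, ?_, e2 z⟩
          rw [upd_self, hH.leaf_iff]
          left
          rw [e1] at hz
          rw [e2] at a b
          rw [hp] at b
          exact ⟨hz, fun e => a (by rw [e]), fun e => b (by rw [e])⟩
        · exact ⟨k, z, hk, by rw [upd_not G H hc]; exact hz, rfl⟩
      · refine ⟨l, app y [k], hl, ?_, (emb_app ..).symm⟩
        rw [upd_self, hH.leaf_iff]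
        exact Or.inr ⟨k, Or.inl rfl⟩
      · refine ⟨l, app ((G l).pair y) [k], hl, ?_, by rw [emb_app, hp]⟩
        rw [upd_self, hH.leaf_iff]
        exact Or.inr ⟨k, Or.inr rfl⟩
    · rintro ⟨k, z, hk, hz, rfl⟩
      rw [hQ.leaf_iff]
      rcases upd_cases G (k := k) hl H with ⟨e1, e2⟩ | ⟨hn, e⟩
      · rw [e1] at hz
        rw [e2]
        rcases (hH.leaf_iff z).mp hz with ⟨hz, a, b⟩ | ⟨j, rfl | rfl⟩
        · left
          exact ⟨(h.leaf_iff _).mpr ⟨l, z, hl, hz, rfl⟩, same z a b⟩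
        · right; exact ⟨j, Or.inl (emb_app ..)⟩
        · right; exact ⟨j, Or.inr (by rw [hp, emb_app])⟩
      · rw [e] at hz
        left
        exact ⟨(h.leaf_iff _).mpr ⟨k, z, hk, hz, rfl⟩, other k z hk hn⟩
  · intro k z hk hz
    rcases upd_cases G (k := k) hl H with ⟨e1, e2⟩ | ⟨hn, e⟩
    · rw [e1] at hz
      rw [e2, e1, e2]
      rcases (hH.leaf_iff z).mp hz with ⟨hz, a, b⟩ | ⟨j, rfl | rfl⟩
      · rw [hH.pair_old z hz a b, hQ.pair_old _ ((h.leaf_iff _).mpr ⟨l, z, hl, hz, rfl⟩)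
          (same z a b).1 (same z a b).2, h.pair_emb _ _ hl hz]
      · rw [hH.pair_l, emb_app, emb_app, hQ.pair_l, hp]
      · rw [hH.pair_l', emb_app, emb_app, ← hp, hQ.pair_l']
    · rw [e] at hz ⊢
      rw [hQ.pair_old _ ((h.leaf_iff _).mpr ⟨k, z, hk, hz, rfl⟩)
          (other k z hk hn).1 (other k z hk hn).2, h.pair_emb _ _ hk hz]

theorem lr_stepB_leaf {Q0 Q Q' H : Couple} {G : NodeId → Couple} {l : NodeId} {r q : Pos}
    {c : Bool} {i : Fin 3} {v : Bool}
    (h : SpecLR Q0 G Q) (hl : Q0.IsLeaf l) (hc : (c, q) = app l r)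
    (hQ : SpecB Q Q' c q i v) (hH : SpecB (G l) H (sgn l) r i v) :
    SpecLR Q0 (upd Q0 G l H) Q' := by
  have hcq : ∀ a, (c, q ++ a) = emb Q0 l (sgn l, r ++ a) := by
    intro a
    rw [emb_self, ← app_app, ← hc]; rfl
  have hcq' : ∀ a, app (emb Q0 l (sgn l, r)) a = (c, q ++ a) := by
    intro a
    rw [emb_self, ← hc]; rfl
  have other : ∀ k z, Q0.IsLeaf k → ¬ (k = l ∨ k = Q0.pair l) →
      bump c q i (loneIdx i v) (emb Q0 k z) = emb Q0 k z := by
    intro k z hk hn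
    apply bump_not
    intro a e
    rw [hcq] at e
    exact hn (emb_inj' hl hk e.symm).1
  have same : ∀ z, bump c q i (loneIdx i v) (emb Q0 l z) =
      emb Q0 l (bump (sgn l) r i (loneIdx i v) z) := by
    intro z
    rcases bump_cases (sgn l) r i (loneIdx i v) z with ⟨a, rfl, h2⟩ | ⟨h1, h2⟩
    · rw [h2, ← hcq, bump_under, hcq]
    · rw [h2, bump_not]
      intro a e
      rw [hcq] at e
      exact h1 a (emb_inj' hl hl e).2
  refine ⟨upd_sym hl H h.sym, ?_, ?_⟩
  · intro x
    constructor
    · intro hx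
      rcases (hQ.leaf_iff x).mp hx with ⟨w, hw, rfl⟩ | ⟨a, b, hab, rfl⟩
      · obtain ⟨k, z, hk, hz, rfl⟩ := (h.leaf_iff w).mp hw
        by_cases hn : k = l ∨ k = Q0.pair l
        · obtain ⟨e1, e2⟩ := G_cases hl h.sym hn
          rw [e1] at hz
          refine ⟨l, _, hl, ?_, by rw [e2, same]⟩
          rw [upd_self, hH.leaf_iff]
          exact Or.inl ⟨z, hz, rfl⟩
        · rw [other k z hk hn]
          exact ⟨k, z, hk, by rw [upd_not G H hn]; exact hz, rfl⟩
      · refine ⟨l, _, hl, ?_, hcq a⟩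
        rw [upd_self, hH.leaf_iff]
        exact Or.inr ⟨a, b, hab, rfl⟩
    · rintro ⟨k, z, hk, hz, rfl⟩
      rw [hQ.leaf_iff]
      rcases upd_cases G (k := k) hl H with ⟨e1, e2⟩ | ⟨hn, e⟩
      · rw [e1] at hz
        rw [e2]
        rcases (hH.leaf_iff z).mp hz with ⟨w, hw, rfl⟩ | ⟨a, b, hab, rfl⟩
        · left
          exact ⟨emb Q0 l w, (h.leaf_iff _).mpr ⟨l, w, hl, hw, rfl⟩, (same w).symm⟩
        · right; exact ⟨a, b, hab, (hcq a).symm⟩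
      · rw [e] at hz
        left
        exact ⟨_, (h.leaf_iff _).mpr ⟨k, z, hk, hz, rfl⟩, (other k z hk hn).symm⟩
  · intro k z hk hz
    rcases upd_cases G (k := k) hl H with ⟨e1, e2⟩ | ⟨hn, e⟩
    · rw [e1] at hz
      rw [e2, e1, e2]
      rcases (hH.leaf_iff z).mp hz with ⟨w, hw, rfl⟩ | ⟨a, b, hab, rfl⟩
      · rw [← same, hQ.pair_bump _ ((h.leaf_iff _).mpr ⟨l, w, hl, hw, rfl⟩),
          h.pair_emb _ _ hl hw, same, hH.pair_bump _ hw]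
      · rw [← hcq, hQ.pair_special a b hab, hH.pair_special a b hab, hcq]
    · rw [e] at hz ⊢
      rw [← other k z hk hn, hQ.pair_bump _ ((h.leaf_iff _).mpr ⟨k, z, hk, hz, rfl⟩),
        h.pair_emb _ _ hk hz, other _ _ hk hn]

open Classical in
/-- Transport of the family of inserted couples under step B performed on `Q0`. -/
noncomputable def pushG (Q0 : Couple) (G : NodeId → Couple) (c : Bool) (q : Pos) (i : Fin 3)
    (v : Bool) : NodeId → Couple := fun x =>
  if h : ∃ y, Q0.IsLeaf y ∧ x = bump c q i (loneIdx i v) y then G h.choose else trivialCouple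

theorem pushG_bump {Q0 : Couple} (G : NodeId → Couple) (c : Bool) (q : Pos) (i : Fin 3)
    (v : Bool) {y : NodeId} (hy : Q0.IsLeaf y) :
    pushG Q0 G c q i v (bump c q i (loneIdx i v) y) = G y := by
  have h : ∃ z, Q0.IsLeaf z ∧ bump c q i (loneIdx i v) y = bump c q i (loneIdx i v) z :=
    ⟨y, hy, rfl⟩
  unfold pushG
  rw [dif_pos h, ← bump_inj h.choose_spec.2]

theorem pushG_special (Q0 : Couple) (G : NodeId → Couple) (c : Bool) (q : Pos) {i : Fin 3}
    {v : Bool} {a b : Pos} (h : SP i v a b) :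
    pushG Q0 G c q i v (c, q ++ a) = trivialCouple := by
  unfold pushG
  rw [dif_neg]
  rintro ⟨y, -, e⟩
  exact bump_ne_special h y e.symm

theorem bump_app {Q0 : Couple} {c : Bool} {q : Pos} (hq : ((Q0.treeOf c).subtreeAt? q).isSome)
    {l : NodeId} (hl : Q0.IsLeaf l) (i j : Fin 3) (r : Pos) :
    bump c q i j (app l r) = app (bump c q i j l) r := by
  rcases bump_cases c q i j l with ⟨a, rfl, h2⟩ | ⟨h1, h2⟩
  · rw [h2]
    simp only [app]
    rw [List.append_assoc, bump_under]
    simp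
  · rw [h2, bump_not]
    intro a e
    obtain ⟨d, p⟩ := l
    simp only [app, Prod.mk.injEq] at e
    obtain ⟨rfl, e⟩ := e
    obtain ⟨e', h3, -⟩ := node_prefix_leaf hq hl e.symm
    exact h1 e' (Prod.ext rfl h3)

theorem lr_stepB_top {Q0 Q Q' Q0' : Couple} {G : NodeId → Couple} {q : Pos}
    {c : Bool} {i : Fin 3} {v : Bool}
    (h : SpecLR Q0 G Q) (hq : ((Q0.treeOf c).subtreeAt? q).isSome)
    (hQ : SpecB Q Q' c q i v) (hQ0 : SpecB Q0 Q0' c q i v) :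
    SpecLR Q0' (pushG Q0 G c q i v) Q' := by
  have hbump : ∀ l y, Q0.IsLeaf l → emb Q0' (bump c q i (loneIdx i v) l) y =
      bump c q i (loneIdx i v) (emb Q0 l y) := by
    intro l y hl
    unfold emb
    rw [sgn_bump, hQ0.pair_bump l hl]
    split_ifs
    · rw [bump_app hq hl]
    · rw [bump_app hq (Q0.leaf_pair hl)]
  refine ⟨?_, ?_, ?_⟩
  · intro l hl
    rcases (hQ0.leaf_iff l).mp hl with ⟨y, hy, rfl⟩ | ⟨a, b, hab, rfl⟩
    · rw [hQ0.pair_bump y hy, pushG_bump G c q i v hy, pushG_bump G c q i v (Q0.leaf_pair hy),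
        h.sym y hy]
    · rw [hQ0.pair_special a b hab, pushG_special Q0 G c q hab, pushG_special Q0 G c q hab.symm]
  · intro x
    constructor
    · intro hx
      rcases (hQ.leaf_iff x).mp hx with ⟨w, hw, rfl⟩ | ⟨a, b, hab, rfl⟩
      · obtain ⟨k, z, hk, hz, rfl⟩ := (h.leaf_iff w).mp hw
        refine ⟨bump c q i (loneIdx i v) k, z, (hQ0.leaf_iff _).mpr (Or.inl ⟨k, hk, rfl⟩), ?_,
          (hbump k z hk).symm⟩
        rw [pushG_bump G c q i v hk]; exact hz
      · refine ⟨(c, q ++ a), (sgn (c, q ++ a), []),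
          (hQ0.leaf_iff _).mpr (Or.inr ⟨a, b, hab, rfl⟩), ?_, emb_root.1.symm⟩
        rw [pushG_special Q0 G c q hab, trivial_leaf]
    · rintro ⟨l, z, hl, hz, rfl⟩
      rw [hQ.leaf_iff]
      rcases (hQ0.leaf_iff l).mp hl with ⟨y, hy, rfl⟩ | ⟨a, b, hab, rfl⟩
      · left
        rw [pushG_bump G c q i v hy] at hz
        exact ⟨emb Q0 y z, (h.leaf_iff _).mpr ⟨y, z, hy, hz, rfl⟩, hbump y z hy⟩
      · right
        rw [pushG_special Q0 G c q hab, trivial_leaf] at hz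
        rcases root_cases (l := (c, q ++ a)) hz with rfl | rfl
        · exact ⟨a, b, hab, emb_root.1⟩
        · exact ⟨b, a, hab.symm, by rw [emb_root.2, hQ0.pair_special a b hab]⟩
  · intro l z hl hz
    rcases (hQ0.leaf_iff l).mp hl with ⟨y, hy, rfl⟩ | ⟨a, b, hab, rfl⟩
    · rw [pushG_bump G c q i v hy] at hz ⊢
      rw [hbump _ _ hy, hbump _ _ hy, hQ.pair_bump _ ((h.leaf_iff _).mpr ⟨y, z, hy, hz, rfl⟩),
        h.pair_emb _ _ hy hz]
    · rw [pushG_special Q0 G c q hab, trivial_leaf] at hz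
      rw [pushG_special Q0 G c q hab]
      rcases root_cases (l := (c, q ++ a)) hz with rfl | rfl
      · rw [trivial_pair, emb_root.1, emb_root.2, hQ.pair_special a b hab,
          hQ0.pair_special a b hab]
      · rw [trivial_pair, Bool.not_not, emb_root.1, emb_root.2, hQ0.pair_special a b hab,
          hQ.pair_special b a hab.symm]

/-! ### The induction -/

/-- The conclusion of the structure theorem. -/
def Concl (Q : Couple) : Prop :=
    ∃ (Q0 : Couple) (G : NodeId → Couple),
      Regular Q0 ∧
      (IsMini11 Q0 ∨ (IsRegularDoubleChain Q0 ∧ Q0 ≠ trivialCouple)) ∧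
      LeafReplace Q0 G Q ∧
      ∀ l, Q0.IsLeaf l → Regular (G l) ∧ (G l).scale < Q.scale

theorem trivial_scale : trivialCouple.scale = 0 := rfl

theorem regular_trivial : Regular trivialCouple := Relation.ReflTransGen.refl

theorem mini_of_stepA {Q : Couple} (h : StepA trivialCouple Q) : IsMini11 Q := by
  obtain ⟨l, σ, hl, hσ, hs⟩ := h.spec
  obtain ⟨l₂, σ₂, hl₂, -, h1, h2, -⟩ := h
  have e2 : ∀ c l, trivialCouple.IsLeaf l →
      graft2 (trivialCouple.treeOf c) c l (trivialCouple.pair l) oneTree = oneTree := by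
    rintro c ⟨d, p⟩ hl
    rw [trivial_leaf] at hl
    simp only at hl
    subst hl
    rw [trivial_pair]
    cases c <;> cases d <;> rfl
  refine ⟨?_, ?_, ?_⟩
  · rw [h1]; exact congrArg TTree.scale (e2 true l₂ hl₂)
  · rw [h2]; exact congrArg TTree.scale (e2 false l₂ hl₂)
  · have hne : (trivialCouple.pair l).1 ≠ l.1 := by
      obtain ⟨d, p⟩ := l
      rw [trivial_leaf] at hl
      simp only at hl
      subst hl
      rw [trivial_pair]
      simp
    have hsides : ∀ x, trivialCouple.IsLeaf x → x = l ∨ x = trivialCouple.pair l := by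
      rintro ⟨c, p⟩ hx
      obtain ⟨d, p'⟩ := l
      rw [trivial_leaf] at hx hl
      simp only at hx hl
      subst hx hl
      rw [trivial_pair]
      cases c <;> cases d <;> simp
    rintro x hx ⟨hsib, -⟩
    rcases (hs.leaf_iff x).mp hx with ⟨h, a, b⟩ | ⟨k, rfl | rfl⟩
    · rcases hsides x h with h | h
      · exact a h
      · exact b h
    · rw [hs.pair_l] at hsib
      exact hne hsib.symm
    · rw [hs.pair_l'] at hsib
      exact hne hsib

theorem concl_top {Q0 Q Q' : Couple} {G : NodeId → Couple} {q : Pos}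
    {c : Bool} {i : Fin 3} {v : Bool} {a b : NodeId}
    (hreg : Regular Q0) (hdc : IsDoubleChain Q0 a b)
    (hq : (Q0.treeOf c).IsBranchPos q ∨ (c, q) = a ∨ (c, q) = b)
    (hnode : ((Q0.treeOf c).subtreeAt? q).isSome)
    (h : LeafReplace Q0 G Q) (hG : ∀ l, Q0.IsLeaf l → Regular (G l) ∧ (G l).scale ≤ Q.scale)
    (hQ : StepBAt Q Q' c q i v) : Concl Q' := by
  obtain ⟨Q0', hQ0⟩ := exists_stepB Q0 c q i v hnode
  refine ⟨Q0', pushG Q0 G c q i v, hreg.tail (Or.inr ⟨c, q, i, v, hQ0⟩),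
    Or.inr ⟨⟨_, _, hdc.step hq hQ0⟩, ?_⟩,
    (lr_stepB_top h.spec hnode hQ.spec hQ0.spec).leafReplace, ?_⟩
  · intro e
    have := hQ0.scale
    rw [e, trivial_scale] at this
    omega
  · intro l hl
    rw [hQ.scale]
    rcases (hQ0.spec.leaf_iff l).mp hl with ⟨y, hy, rfl⟩ | ⟨a, b, hab, rfl⟩
    · rw [pushG_bump G c q i v hy]
      exact ⟨(hG y hy).1, by have := (hG y hy).2; omega⟩
    · rw [pushG_special Q0 G c q hab, trivial_scale]
      exact ⟨regular_trivial, by omega⟩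

theorem concl_root {Q Q' : Couple} {c : Bool} {i : Fin 3} {v : Bool} (hreg : Regular Q)
    (hQ : StepBAt Q Q' c [] i v) : Concl Q' := by
  refine concl_top regular_trivial IsDoubleChain.triv ?_ ?_ (lr_trivial Q)
    (fun l _ => ⟨hreg, le_refl _⟩) hQ
  · cases c <;> simp
  · simp [subtree_nil]

theorem concl_upd {Q0 Q Q' H : Couple} {G : NodeId → Couple} {l : NodeId}
    (hreg : Regular Q0)
    (hm : IsMini11 Q0 ∨ (IsRegularDoubleChain Q0 ∧ Q0 ≠ trivialCouple))
    (hG : ∀ l, Q0.IsLeaf l → Regular (G l) ∧ (G l).scale < Q.scale) (hl : Q0.IsLeaf l)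
    (hH : Step (G l) H) (hs : H.scale = (G l).scale + 2) (hs' : Q'.scale = Q.scale + 2)
    (h : SpecLR Q0 (upd Q0 G l H) Q') : Concl Q' := by
  refine ⟨Q0, upd Q0 G l H, hreg, hm, h.leafReplace, ?_⟩
  intro k hk
  rcases upd_cases G (k := k) hl H with ⟨e, -⟩ | ⟨-, e⟩
  · rw [e]
    exact ⟨(hG l hl).1.tail hH, by have := (hG l hl).2; omega⟩
  · rw [e]
    exact ⟨(hG k hk).1, by have := (hG k hk).2; omega⟩

theorem scale_one_branch {t : TTree} (h : t.scale = 1) {q : Pos} (hq : t.IsBranchPos q) :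
    q = [] := by
  obtain ⟨a, b, c, hq⟩ := hq
  cases q with
  | nil => rfl
  | cons k q =>
    exfalso
    cases t with
    | leaf => simp [subtree_leaf_cons] at hq
    | node t0 t1 t2 =>
      simp only [TTree.scale] at h
      rw [subtree_cons] at hq
      have hk : (ch t0 t1 t2 k).scale = 0 := by
        unfold ch
        split_ifs <;> omega
      have h3 : ch t0 t1 t2 k = .leaf := by
        cases hh : ch t0 t1 t2 k with
        | leaf => rfl
        | node x y z => rw [hh] at hk; simp [TTree.scale] at hk
      rw [h3] at hq
      cases q with
      | nil => simp [subtree_nil] at hq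
      | cons j q => simp [subtree_leaf_cons] at hq

theorem concl_step {Q Q' : Couple} (hreg : Regular Q) (ih : Q = trivialCouple ∨ Concl Q)
    (hst : Step Q Q') : Concl Q' := by
  rcases hst with hA | ⟨c, q, i, v, hB⟩
  · rcases ih with rfl | ⟨Q0, G, hr0, hm, hlr, hG⟩
    · refine ⟨Q', fun _ => trivialCouple, regular_trivial.tail (Or.inl hA),
        Or.inl (mini_of_stepA hA), lr_self Q', ?_⟩
      intro l _
      have := hA.scale
      rw [trivial_scale] at *
      exact ⟨regular_trivial, by omega⟩
    · obtain ⟨x, σ, hx, hσ, hs⟩ := hA.spec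
      have hsp := hlr.spec
      obtain ⟨l, y, hl, hy, rfl⟩ := (hsp.leaf_iff x).mp hx
      obtain ⟨H, hH, hHs⟩ := exists_stepA (G l) y σ hy hσ
      exact concl_upd hr0 hm hG hl (Or.inl hH) hH.scale hA.scale (lr_stepA hsp hl hy hs hHs)
  · by_cases hq : q = []
    · subst hq
      exact concl_root hreg hB
    rcases ih with rfl | ⟨Q0, G, hr0, hm, hlr, hG⟩
    · exfalso
      have := hB.node
      cases q with
      | nil => exact hq rfl
      | cons k q => cases c <;> simp [Couple.treeOf, trivialCouple, subtree_leaf_cons] at this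
    · rcases hlr.node hB.node with hb | ⟨l, r, hcq, hl, hr⟩
      · rcases hm with ⟨h1, h2, -⟩ | ⟨⟨a, b, hdc⟩, -⟩
        · exfalso
          have : (Q0.treeOf c).scale = 1 := by cases c <;> assumption
          exact hq (scale_one_branch this hb)
        · have hnode : ((Q0.treeOf c).subtreeAt? q).isSome := by
            obtain ⟨_, _, _, e⟩ := hb
            rw [e]; rfl
          exact concl_top hr0 hdc (Or.inl hb) hnode hlr
            (fun l hl => ⟨(hG l hl).1, (hG l hl).2.le⟩) hB
      · obtain ⟨H, hH⟩ := exists_stepB (G l) (sgn l) r i v hr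
        exact concl_upd hr0 hm hG hl (Or.inr ⟨_, _, _, _, hH⟩) hH.scale hB.scale
          (lr_stepB_leaf hlr.spec hl hcq hB.spec hH.spec)

theorem concl_all {Q : Couple} (hreg : Regular Q) : Q = trivialCouple ∨ Concl Q := by
  induction hreg with
  | refl => exact Or.inl rfl
  | tail h hst ih => exact Or.inr (concl_step h ih hst)

/-- Proposition 3.5 of Deng–Hani (structure theorem for regular couples): every nontrivial
regular couple `Q` is obtained from a regular couple `Q0`, which is either a (1,1)-mini
couple or a nontrivial regular double chain, by replacing each pair of paired leaves of
`Q0` by a regular couple of scale strictly smaller than the scale of `Q`. -/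
theorem structure_of_regular_couples (Q : Couple) (hreg : Regular Q)
    (hnt : Q ≠ trivialCouple) :
    ∃ (Q0 : Couple) (G : NodeId → Couple),
      Regular Q0 ∧
      (IsMini11 Q0 ∨ (IsRegularDoubleChain Q0 ∧ Q0 ≠ trivialCouple)) ∧
      LeafReplace Q0 G Q ∧
      ∀ l, Q0.IsLeaf l → Regular (G l) ∧ (G l).scale < Q.scale := by
  exact (concl_all hreg).resolve_left hnt

end WKE
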